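/- For z ∈ ℝ^N and u : ℝ^N → ℝ set S_j(z,u) = sup_{B(z,2^{−j})} |u|. There exists a constant C depending only on N such that for every u ∈ P₁(z,M) and every j ∈ ℕ, S_j(z,u) ≤ C·M·2^{−2j}. -/

import Mathlib

open MeasureTheory Metric Set Filter
open scoped RealInnerProductSpace

noncomputable section

/-- The Laplacian of `φ` at `x`, as the sum of the pure second derivatives. -/
def lap (N : ℕ) (φ : EuclideanSpace ℝ (Fin N) → ℝ) (x : EuclideanSpace ℝ (Fin N)) : ℝ :=
  ∑ i : Fin N,
    fderiv ℝ (fun y => fderiv ℝ φ y (EuclideanSpace.single i 1)) x (EuclideanSpace.single i 1)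

/-- Membership in the class `P_r(z, M)`. -/
def MemP (N : ℕ) (r : ℝ) (z : EuclideanSpace ℝ (Fin N)) (M : ℝ)
    (Ω : Set (EuclideanSpace ℝ (Fin N))) (u : EuclideanSpace ℝ (Fin N) → ℝ) : Prop :=
  IsOpen Ω ∧ ContDiff ℝ 1 u ∧
    (∀ φ : EuclideanSpace ℝ (Fin N) → ℝ, ContDiff ℝ (⊤ : ℕ∞) φ → tsupport φ ⊆ ball z r →
      ∫ x, u x * lap N φ x = ∫ x in Ω, φ x) ∧
    (∀ x ∈ ball z r \ Ω, u x = 0 ∧ gradient u x = 0) ∧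
    (∀ x ∈ ball z r, |u x| ≤ M) ∧
    z ∈ frontier Ω

/-- Membership in the class `P_∞(0, M)` of global solutions with quadratic growth. -/
def MemPinf (N : ℕ) (M : ℝ) (Ω : Set (EuclideanSpace ℝ (Fin N)))
    (u : EuclideanSpace ℝ (Fin N) → ℝ) : Prop :=
  IsOpen Ω ∧ ContDiff ℝ 1 u ∧
    (∀ φ : EuclideanSpace ℝ (Fin N) → ℝ, ContDiff ℝ (⊤ : ℕ∞) φ → HasCompactSupport φ →
      ∫ x, u x * lap N φ x = ∫ x in Ω, φ x) ∧
    (∀ x ∈ Ωᶜ, u x = 0 ∧ gradient u x = 0) ∧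
    (0 : EuclideanSpace ℝ (Fin N)) ∈ frontier Ω ∧
    (∀ x, |u x| ≤ M * (‖x‖ ^ 2 + 1))

/-- The minimum diameter of a set: the smallest width of a slab containing it. -/
def MD (N : ℕ) (D : Set (EuclideanSpace ℝ (Fin N))) : ℝ :=
  ⨅ e : {e : EuclideanSpace ℝ (Fin N) // ‖e‖ = 1},
    ((⨆ x : D, ⟪(x : EuclideanSpace ℝ (Fin N)), (e : EuclideanSpace ℝ (Fin N))⟫) -
      ⨅ x : D, ⟪(x : EuclideanSpace ℝ (Fin N)), (e : EuclideanSpace ℝ (Fin N))⟫)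

/-- The density function `δ_r(u)`. -/
def deltaFn (N : ℕ) (u : EuclideanSpace ℝ (Fin N) → ℝ) (r : ℝ) : ℝ :=
  MD N ({x | u x = 0 ∧ gradient u x = 0} ∩ ball 0 r) / r

/-- Half-space solutions `x ↦ (max(⟪x,e⟫,0))²/2`. -/
def IsHalfSpaceSol (N : ℕ) (u : EuclideanSpace ℝ (Fin N) → ℝ) : Prop :=
  ∃ e : EuclideanSpace ℝ (Fin N), ‖e‖ = 1 ∧ ∀ x, u x = (max ⟪x, e⟫ 0) ^ 2 / 2

/-- `∂Ω ∩ B` is the graph of a `C¹` function. -/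
def IsC1Graph (N : ℕ) (Ω B : Set (EuclideanSpace ℝ (Fin N))) : Prop :=
  ∃ (e : EuclideanSpace ℝ (Fin N)) (f : EuclideanSpace ℝ (Fin N) → ℝ),
    ‖e‖ = 1 ∧ ContDiff ℝ 1 f ∧
    Ω ∩ B = {x ∈ B | f (x - ⟪x, e⟫ • e) < ⟪x, e⟫} ∧
    frontier Ω ∩ B = {x ∈ B | ⟪x, e⟫ = f (x - ⟪x, e⟫ • e)}

/-- `∂Ω ∩ B` is the graph of a real-analytic function. -/
def IsAnalyticGraph (N : ℕ) (Ω B : Set (EuclideanSpace ℝ (Fin N))) : Prop :=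
  ∃ (e : EuclideanSpace ℝ (Fin N)) (f : EuclideanSpace ℝ (Fin N) → ℝ),
    ‖e‖ = 1 ∧ (∀ x, AnalyticAt ℝ f x) ∧
    Ω ∩ B = {x ∈ B | f (x - ⟪x, e⟫ • e) < ⟪x, e⟫} ∧
    frontier Ω ∩ B = {x ∈ B | ⟪x, e⟫ = f (x - ⟪x, e⟫ • e)}

/-- The Alt–Caffarelli–Friedman functional `φ(r, v)` centered at the origin. -/
def acf (N : ℕ) (v : EuclideanSpace ℝ (Fin N) → ℝ) (r : ℝ) : ℝ :=
  r ^ (-4 : ℤ) *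
    (∫ x in ball (0 : EuclideanSpace ℝ (Fin N)) r,
      ‖gradient (fun y => max (v y) 0) x‖ ^ 2 * ‖x‖ ^ ((2 : ℤ) - (N : ℤ))) *
    ∫ x in ball (0 : EuclideanSpace ℝ (Fin N)) r,
      ‖gradient (fun y => max (-v y) 0) x‖ ^ 2 * ‖x‖ ^ ((2 : ℤ) - (N : ℤ))

/-- `S_j(z, u) = sup_{B(z, 2^{-j})} |u|`. -/
def Sj (N : ℕ) (z : EuclideanSpace ℝ (Fin N)) (u : EuclideanSpace ℝ (Fin N) → ℝ) (j : ℕ) : ℝ :=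
  sSup ((fun x => |u x|) '' ball z ((2 : ℝ) ^ (-(j : ℤ))))

open scoped Topology

/-- The directional derivative of `f` along `a`, as a function. -/
def dirDeriv {N : ℕ} (a : EuclideanSpace ℝ (Fin N)) (f : EuclideanSpace ℝ (Fin N) → ℝ) :
    EuclideanSpace ℝ (Fin N) → ℝ :=
  fun x => fderiv ℝ f x a

section DirDeriv

lemma two_le_top : minSmoothness ℝ 2 ≤ ((⊤ : ℕ∞) : WithTop ℕ∞) := by
  simp only [minSmoothness_of_isRCLikeNormedField]
  exact WithTop.coe_le_coe.2 (le_top : (2 : ℕ∞) ≤ ⊤)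

variable {N : ℕ} {f g : EuclideanSpace ℝ (Fin N) → ℝ}

lemma lap_eq_sum_dirDeriv (f : EuclideanSpace ℝ (Fin N) → ℝ) :
    lap N f = fun x => ∑ i : Fin N,
      dirDeriv (EuclideanSpace.single i 1) (dirDeriv (EuclideanSpace.single i 1) f) x :=
  rfl

lemma ContDiff.dirDeriv (hf : ContDiff ℝ (⊤ : ℕ∞) f) (a : EuclideanSpace ℝ (Fin N)) :
    ContDiff ℝ (⊤ : ℕ∞) (dirDeriv a f) :=
  (hf.fderiv_right (m := (⊤ : ℕ∞)) (by simp)).clm_apply contDiff_const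

lemma ContDiff.differentiable_of_top (hf : ContDiff ℝ (⊤ : ℕ∞) f) : Differentiable ℝ f :=
  hf.differentiable (by simp)

lemma tsupport_dirDeriv_subset (a : EuclideanSpace ℝ (Fin N)) :
    tsupport (dirDeriv a f) ⊆ tsupport f :=
  tsupport_fderiv_apply_subset ℝ a

lemma fderiv_dirDeriv (hf : ContDiff ℝ (⊤ : ℕ∞) f) (a b x : EuclideanSpace ℝ (Fin N)) :
    fderiv ℝ (dirDeriv a f) x b = fderiv ℝ (fderiv ℝ f) x b a := by
  have h : DifferentiableAt ℝ (fderiv ℝ f) x :=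
    (hf.fderiv_right (m := (⊤ : ℕ∞)) (by simp)).differentiable (by simp) x
  have := (h.hasFDerivAt.clm_apply (hasFDerivAt_const a x)).fderiv
  rw [show dirDeriv a f = fun y => fderiv ℝ f y a from rfl, this]
  simp

lemma dirDeriv_comm (hf : ContDiff ℝ (⊤ : ℕ∞) f) (a b : EuclideanSpace ℝ (Fin N)) :
    dirDeriv a (dirDeriv b f) = dirDeriv b (dirDeriv a f) := by
  funext x
  change fderiv ℝ (dirDeriv b f) x a = fderiv ℝ (dirDeriv a f) x b
  rw [fderiv_dirDeriv hf, fderiv_dirDeriv hf]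
  exact (hf.contDiffAt.isSymmSndFDerivAt two_le_top) a b

lemma dirDeriv_sum (F : Fin N → EuclideanSpace ℝ (Fin N) → ℝ)
    (hF : ∀ i, ContDiff ℝ (⊤ : ℕ∞) (F i)) (a x : EuclideanSpace ℝ (Fin N)) :
    dirDeriv a (fun y => ∑ i, F i y) x = ∑ i, dirDeriv a (F i) x := by
  change fderiv ℝ (fun y => ∑ i, F i y) x a = _
  rw [fderiv_fun_sum fun i _ => (hF i).differentiable_of_top x]
  simp [dirDeriv]

lemma lap_dirDeriv (hf : ContDiff ℝ (⊤ : ℕ∞) f) (a : EuclideanSpace ℝ (Fin N)) :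
    lap N (dirDeriv a f) = dirDeriv a (lap N f) := by
  funext x
  rw [lap_eq_sum_dirDeriv, lap_eq_sum_dirDeriv, dirDeriv_sum _ fun i => (hf.dirDeriv _).dirDeriv _]
  refine Finset.sum_congr rfl fun i _ => ?_
  rw [dirDeriv_comm hf, dirDeriv_comm (hf.dirDeriv _)]

/-- The derivative of `f` in the radial direction. -/
def euler (f : EuclideanSpace ℝ (Fin N) → ℝ) (x : EuclideanSpace ℝ (Fin N)) : ℝ :=
  fderiv ℝ f x x

lemma hasFDerivAt_euler (hf : ContDiff ℝ (⊤ : ℕ∞) f) (x : EuclideanSpace ℝ (Fin N)) :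
    HasFDerivAt (euler f) ((fderiv ℝ f x).comp (ContinuousLinearMap.id ℝ _) +
      (fderiv ℝ (fderiv ℝ f) x).flip x) x := by
  have h : DifferentiableAt ℝ (fderiv ℝ f) x :=
    (hf.fderiv_right (m := (⊤ : ℕ∞)) (by simp)).differentiable (by simp) x
  exact h.hasFDerivAt.clm_apply (hasFDerivAt_id x)

lemma dirDeriv_euler (hf : ContDiff ℝ (⊤ : ℕ∞) f) (a x : EuclideanSpace ℝ (Fin N)) :
    dirDeriv a (euler f) x = dirDeriv a f x + euler (dirDeriv a f) x := by
  change fderiv ℝ (euler f) x a = fderiv ℝ f x a + fderiv ℝ (dirDeriv a f) x x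
  rw [(hasFDerivAt_euler hf x).fderiv, fderiv_dirDeriv hf,
    (hf.contDiffAt.isSymmSndFDerivAt two_le_top).eq x a]
  simp

/-- A pair of smooth kernels supported in the closed unit ball, related by
`Δζ = -(m k + x · ∇k)`. -/
structure KernelPair (m : ℕ) (ζ k : EuclideanSpace ℝ (Fin N) → ℝ) : Prop where
  smooth_left : ContDiff ℝ (⊤ : ℕ∞) ζ
  smooth_right : ContDiff ℝ (⊤ : ℕ∞) k
  support_left : tsupport ζ ⊆ closedBall 0 1
  support_right : tsupport k ⊆ closedBall 0 1
  lap_eq : ∀ x, lap N ζ x = -(m * k x + euler k x)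

lemma KernelPair.directional {m : ℕ} {ζ k : EuclideanSpace ℝ (Fin N) → ℝ} (h : KernelPair m ζ k)
    (a : EuclideanSpace ℝ (Fin N)) : KernelPair (m + 1) (dirDeriv a ζ) (dirDeriv a k) where
  smooth_left := h.smooth_left.dirDeriv a
  smooth_right := h.smooth_right.dirDeriv a
  support_left := (tsupport_dirDeriv_subset a).trans h.support_left
  support_right := (tsupport_dirDeriv_subset a).trans h.support_right
  lap_eq x := by
    rw [lap_dirDeriv h.smooth_left, show lap N ζ = fun x => -(m * k x + euler k x) from
      funext h.lap_eq]
    have hd := dirDeriv_euler h.smooth_right a x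
    have he := (hasFDerivAt_euler h.smooth_right x).differentiableAt
    have hk := h.smooth_right.differentiable_of_top x
    have : dirDeriv a (fun x => -(m * k x + euler k x)) x
        = -(m * dirDeriv a k x + dirDeriv a (euler k) x) := by
      simp only [dirDeriv]
      rw [fderiv_fun_neg, fderiv_fun_add (hk.const_mul _) he, fderiv_const_mul hk]
      simp
    rw [this, hd]
    push_cast
    ring

end DirDeriv

/-- A pair of radial profiles: `η` is a probability density and `ψ` a potential with
`∇ψ = -x η`. -/
structure RadialPair {N : ℕ} (ψ η : EuclideanSpace ℝ (Fin N) → ℝ) : Prop where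
  smooth_left : ContDiff ℝ (⊤ : ℕ∞) ψ
  smooth_right : ContDiff ℝ (⊤ : ℕ∞) η
  support_left : tsupport ψ ⊆ closedBall 0 1
  support_right : tsupport η ⊆ closedBall 0 1
  nonneg_right : ∀ x, 0 ≤ η x
  even_right : ∀ x, η (-x) = η x
  integral_right : ∫ x, η x = 1
  integral_left_pos : 0 < ∫ x, ψ x
  fderiv_eq : ∀ x a, fderiv ℝ ψ x a = -⟪x, a⟫ * η x

lemma RadialPair.kernelPair {N : ℕ} {ψ η : EuclideanSpace ℝ (Fin N) → ℝ} (h : RadialPair ψ η) :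
    KernelPair N ψ η where
  smooth_left := h.smooth_left
  smooth_right := h.smooth_right
  support_left := h.support_left
  support_right := h.support_right
  lap_eq x := by
    have key : ∀ i : Fin N, dirDeriv (EuclideanSpace.single i 1)
        (dirDeriv (EuclideanSpace.single i 1) ψ) x
        = -(η x + x i * fderiv ℝ η x (EuclideanSpace.single i 1)) := by
      intro i
      have e : dirDeriv (EuclideanSpace.single i 1) ψ
          = fun y => -⟪y, EuclideanSpace.single i (1 : ℝ)⟫ * η y := by
        funext y; exact h.fderiv_eq y _
      rw [e]
      have hη := (h.smooth_right.differentiable_of_top x).hasFDerivAt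
      have hin : HasFDerivAt (fun y : EuclideanSpace ℝ (Fin N) =>
          -⟪y, EuclideanSpace.single i (1 : ℝ)⟫)
          (-(innerSL ℝ (EuclideanSpace.single i (1 : ℝ)))) x := by
        have := (innerSL ℝ (EuclideanSpace.single i (1 : ℝ))).hasFDerivAt (x := x)
        refine (this.neg).congr_of_eventuallyEq (Eventually.of_forall fun y => ?_)
        simp [real_inner_comm]
      have := (hin.mul hη).fderiv
      simp only [dirDeriv]
      erw [this]
      simp [EuclideanSpace.inner_single_right]
    have hx : euler η x = ∑ i, x i * fderiv ℝ η x (EuclideanSpace.single i 1) := by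
      conv_lhs => rw [euler]
      conv_lhs =>
        arg 2
        rw [← (EuclideanSpace.basisFun (Fin N) ℝ).sum_repr x]
      rw [map_sum]
      simp
    rw [lap_eq_sum_dirDeriv, hx]
    simp only [key]
    simp [Finset.sum_add_distrib]

lemma exists_radialPair {N : ℕ} (hN : 1 ≤ N) :
    ∃ ψ η : EuclideanSpace ℝ (Fin N) → ℝ, RadialPair ψ η := by
  set T := Real.smoothTransition
  have hT : ContDiff ℝ (⊤ : ℕ∞) T := Real.smoothTransition.contDiff
  have hT' : ContDiff ℝ (⊤ : ℕ∞) (deriv T) := by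
    have := (contDiff_infty_iff_deriv ).1 hT
    exact this.2
  let q : EuclideanSpace ℝ (Fin N) → ℝ := fun x => 1 - 2 * ‖x‖ ^ 2
  have hq : ContDiff ℝ (⊤ : ℕ∞) q := contDiff_const.sub (contDiff_const.mul (contDiff_norm_sq ℝ))
  let ψ₀ : EuclideanSpace ℝ (Fin N) → ℝ := fun x => T (q x)
  let η₀ : EuclideanSpace ℝ (Fin N) → ℝ := fun x => 4 * deriv T (q x)
  have hψ : ContDiff ℝ (⊤ : ℕ∞) ψ₀ := hT.comp hq
  have hη : ContDiff ℝ (⊤ : ℕ∞) η₀ := contDiff_const.mul (hT'.comp hq)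
  have hqout : ∀ x : EuclideanSpace ℝ (Fin N), 1 < ‖x‖ → q x < 0 := by
    intro x hx; simp only [q]; nlinarith
  have hsψ : tsupport ψ₀ ⊆ closedBall 0 1 := by
    refine closure_minimal (fun x hx => ?_) isClosed_closedBall
    by_contra hc
    simp only [mem_closedBall, dist_zero_right, not_le] at hc
    exact hx (Real.smoothTransition.zero_of_nonpos (hqout x hc).le)
  have hsη : tsupport η₀ ⊆ closedBall 0 1 := by
    refine closure_minimal (fun x hx => ?_) isClosed_closedBall
    by_contra hc
    simp only [mem_closedBall, dist_zero_right, not_le] at hc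
    have h0 : T =ᶠ[𝓝 (q x)] fun _ => 0 := by
      filter_upwards [Iio_mem_nhds (hqout x hc)] with s hs
      exact Real.smoothTransition.zero_of_nonpos (le_of_lt hs)
    exact hx (by simp [η₀, h0.deriv_eq])
  have hηn : ∀ x, 0 ≤ η₀ x := fun x => by
    have : 0 ≤ deriv T (q x) := Real.smoothTransition.monotone.deriv_nonneg
    simp only [η₀]; positivity
  have hfd : ∀ x a, fderiv ℝ ψ₀ x a = -⟪x, a⟫ * η₀ x := by
    intro x a
    have h1 : HasDerivAt T (deriv T (q x)) (q x) :=
      (hT.differentiable (by simp) _).hasDerivAt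
    have h2 : HasFDerivAt q (-((2 : ℝ) • (2 : ℕ) • innerSL ℝ x)) x := by
      have := ((hasStrictFDerivAt_norm_sq x).hasFDerivAt.const_mul (2 : ℝ)).const_sub 1
      exact this
    have := (h1.comp_hasFDerivAt x h2).fderiv
    change fderiv ℝ (T ∘ q) x a = _
    rw [this]
    simp [η₀]
    ring
  have hcη : HasCompactSupport η₀ := (isCompact_closedBall 0 1).of_isClosed_subset
    (isClosed_tsupport _) hsη
  have hcψ : HasCompactSupport ψ₀ := (isCompact_closedBall 0 1).of_isClosed_subset
    (isClosed_tsupport _) hsψ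
  have hiψ : 0 < ∫ x, ψ₀ x := by
    refine hψ.continuous.integral_pos_of_hasCompactSupport_nonneg_nonzero hcψ
      (fun x => Real.smoothTransition.nonneg _) (x := 0) ?_
    simp [ψ₀, q, T]
  have hiη : 0 < ∫ x, η₀ x := by
    obtain ⟨x, hx⟩ : ∃ x, η₀ x ≠ 0 := by
      by_contra! hc
      have hz : ∀ x, fderiv ℝ ψ₀ x = 0 := fun x => by
        ext a; simp [hfd, hc]
      have := is_const_of_fderiv_eq_zero (hψ.differentiable (by simp)) hz 0
        (EuclideanSpace.single ⟨0, hN⟩ 1)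
      simp only [ψ₀, q] at this
      norm_num at this
      rw [show T 1 = 1 from Real.smoothTransition.one,
        show T (-1) = 0 from Real.smoothTransition.zero_of_nonpos (by norm_num)] at this
      norm_num at this
    exact hη.continuous.integral_pos_of_hasCompactSupport_nonneg_nonzero hcη hηn hx
  set c := ∫ x, η₀ x
  refine ⟨fun x => c⁻¹ * ψ₀ x, fun x => c⁻¹ * η₀ x, ?_⟩
  refine ⟨contDiff_const.mul hψ, contDiff_const.mul hη, ?_, ?_, ?_, ?_, ?_, ?_, ?_⟩
  · exact (closure_mono (Function.support_const_smul_subset c⁻¹ _)).trans hsψ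
  · exact (closure_mono (Function.support_const_smul_subset c⁻¹ _)).trans hsη
  · exact fun x => mul_nonneg (inv_nonneg.2 hiη.le) (hηn x)
  · intro x; simp [η₀, q]
  · rw [integral_const_mul]; exact inv_mul_cancel₀ hiη.ne'
  · rw [integral_const_mul]; positivity
  · intro x a
    rw [fderiv_const_mul (hψ.differentiable_of_top x)]
    simp [hfd]; ring

section Average

variable {N : ℕ}

/-- The kernel `k` integrated against `u` at centre `y` and scale `ρ`, with weight `ρ ^ (-m)`. -/
def avg (m : ℕ) (k u : EuclideanSpace ℝ (Fin N) → ℝ) (y : EuclideanSpace ℝ (Fin N)) (ρ : ℝ) : ℝ :=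
  (ρ ^ m)⁻¹ * ∫ x, u x * k (ρ⁻¹ • (x - y))

variable {k u ζ : EuclideanSpace ℝ (Fin N) → ℝ} {y z : EuclideanSpace ℝ (Fin N)} {ρ : ℝ}

lemma kernel_eq_zero (hk : tsupport k ⊆ closedBall 0 1) {w : EuclideanSpace ℝ (Fin N)}
    (hw : 1 < ‖w‖) : k w = 0 := by
  by_contra h
  have := hk (subset_tsupport _ h)
  rw [mem_closedBall, dist_zero_right] at this
  linarith

lemma scaled_kernel_eq_zero (hk : tsupport k ⊆ closedBall 0 1) (hρ : 0 < ρ)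
    {x : EuclideanSpace ℝ (Fin N)} (hx : x ∉ closedBall y ρ) : k (ρ⁻¹ • (x - y)) = 0 := by
  refine kernel_eq_zero hk ?_
  rw [mem_closedBall, dist_eq_norm, not_le] at hx
  rw [norm_smul, Real.norm_of_nonneg (by positivity), inv_mul_eq_div, one_lt_div hρ]
  exact hx

lemma tsupport_scaled_kernel (hk : tsupport k ⊆ closedBall 0 1) (hρ : 0 < ρ) :
    tsupport (fun x => k (ρ⁻¹ • (x - y))) ⊆ closedBall y ρ :=
  closure_minimal (fun _ hx => by_contra fun hc => hx (scaled_kernel_eq_zero hk hρ hc))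
    isClosed_closedBall

lemma hasCompactSupport_scaled_kernel (hk : tsupport k ⊆ closedBall 0 1) (hρ : 0 < ρ) :
    HasCompactSupport (fun x => k (ρ⁻¹ • (x - y))) :=
  (isCompact_closedBall y ρ).of_isClosed_subset (isClosed_tsupport _)
    (tsupport_scaled_kernel hk hρ)

lemma hasCompactSupport_kernel (hk : tsupport k ⊆ closedBall 0 1) : HasCompactSupport k :=
  (isCompact_closedBall 0 1).of_isClosed_subset (isClosed_tsupport _) hk

lemma integrable_mul_scaled_kernel (hu : Continuous u) (hkc : Continuous k)
    (hk : tsupport k ⊆ closedBall 0 1) (hρ : 0 < ρ) :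
    Integrable (fun x => u x * k (ρ⁻¹ • (x - y))) :=
  (hu.mul (hkc.comp (by fun_prop))).integrable_of_hasCompactSupport
    (hasCompactSupport_scaled_kernel hk hρ).mul_left

lemma contDiff_scaled_kernel (hk : ContDiff ℝ (⊤ : ℕ∞) k) (c : ℝ)
    (y : EuclideanSpace ℝ (Fin N)) : ContDiff ℝ (⊤ : ℕ∞) (fun x => k (c • (x - y))) :=
  hk.comp (by fun_prop)

lemma dirDeriv_scaled (hk : ContDiff ℝ (⊤ : ℕ∞) k) (c : ℝ) (y a : EuclideanSpace ℝ (Fin N)) :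
    dirDeriv a (fun x => k (c • (x - y))) = fun x => c * dirDeriv a k (c • (x - y)) := by
  funext x
  have h1 : HasFDerivAt (fun x : EuclideanSpace ℝ (Fin N) => c • (x - y))
      (c • ContinuousLinearMap.id ℝ _) x :=
    ((hasFDerivAt_id x).sub_const y).const_smul c
  have h2 := (hk.differentiable_of_top (c • (x - y))).hasFDerivAt.comp x h1
  change fderiv ℝ (k ∘ fun x => c • (x - y)) x a = _
  rw [h2.fderiv]
  simp [dirDeriv]

lemma lap_scaled (hk : ContDiff ℝ (⊤ : ℕ∞) k) (c : ℝ) (y x : EuclideanSpace ℝ (Fin N)) :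
    lap N (fun x => k (c • (x - y))) x = c ^ 2 * lap N k (c • (x - y)) := by
  rw [lap_eq_sum_dirDeriv, lap_eq_sum_dirDeriv, Finset.mul_sum]
  refine Finset.sum_congr rfl fun i _ => ?_
  set e : EuclideanSpace ℝ (Fin N) := EuclideanSpace.single i 1
  have h1 : dirDeriv e (fun x => c * dirDeriv e k (c • (x - y)))
      = fun x => c * dirDeriv e (fun x => dirDeriv e k (c • (x - y))) x := by
    funext x
    simp only [dirDeriv]
    rw [fderiv_const_mul]
    · rfl
    · exact (contDiff_scaled_kernel (hk.dirDeriv e) c y).differentiable_of_top x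
  rw [dirDeriv_scaled hk, h1, dirDeriv_scaled (hk.dirDeriv e)]
  ring

lemma continuous_euler (hk : ContDiff ℝ (⊤ : ℕ∞) k) : Continuous (euler k) :=
  (hk.continuous_fderiv (by simp)).clm_apply continuous_id

lemma euler_eq_zero (hk : tsupport k ⊆ closedBall 0 1) {w : EuclideanSpace ℝ (Fin N)}
    (hw : 1 < ‖w‖) : euler k w = 0 := by
  have h : w ∉ tsupport (fderiv ℝ k) := fun hc => by
    have := hk (tsupport_fderiv_subset ℝ hc)
    rw [mem_closedBall, dist_zero_right] at this
    linarith
  simp [euler, image_eq_zero_of_notMem_tsupport h]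

lemma hasDerivAt_scaled_kernel (hk : ContDiff ℝ (⊤ : ℕ∞) k) (v : EuclideanSpace ℝ (Fin N))
    (hρ : ρ ≠ 0) :
    HasDerivAt (fun r : ℝ => k (r⁻¹ • v)) (-(ρ⁻¹ * euler k (ρ⁻¹ • v))) ρ := by
  have h1 : HasDerivAt (fun r : ℝ => r⁻¹ • v) (-(ρ ^ 2)⁻¹ • v) ρ :=
    (hasDerivAt_inv hρ).smul_const v
  have h2 := (hk.differentiable_of_top (ρ⁻¹ • v)).hasFDerivAt.comp_hasDerivAt ρ h1
  refine h2.congr_deriv ?_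
  simp only [euler, map_smul, smul_eq_mul]
  field_simp

lemma hasDerivAt_avg_aux (m : ℕ) (hu : Continuous u) (hks : ContDiff ℝ (⊤ : ℕ∞) k)
    (hk : tsupport k ⊆ closedBall 0 1) (y : EuclideanSpace ℝ (Fin N)) (hρ : 0 < ρ) :
    HasDerivAt (avg m k u y)
      (-(ρ ^ (m + 1))⁻¹ * ∫ x, u x * (m * k (ρ⁻¹ • (x - y)) + euler k (ρ⁻¹ • (x - y)))) ρ := by
  set F' : ℝ → EuclideanSpace ℝ (Fin N) → ℝ :=
    fun r x => u x * -(r⁻¹ * euler k (r⁻¹ • (x - y)))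
  have hE := continuous_euler hks
  set Q : Set (ℝ × EuclideanSpace ℝ (Fin N)) := Icc (ρ / 2) (2 * ρ) ×ˢ closedBall y (2 * ρ)
  have hQ : IsCompact Q := isCompact_Icc.prod (isCompact_closedBall _ _)
  have hcont : ContinuousOn (fun p : ℝ × EuclideanSpace ℝ (Fin N) => F' p.1 p.2) Q := by
    have hinv : ContinuousOn (fun p : ℝ × EuclideanSpace ℝ (Fin N) => p.1⁻¹) Q :=
      continuousOn_fst.inv₀ fun p hp => by
        have := (mem_Icc.1 hp.1).1
        linarith
    refine (hu.comp_continuousOn continuousOn_snd).mul ((hinv.mul ?_).neg)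
    exact hE.comp_continuousOn (hinv.smul (continuousOn_snd.sub continuousOn_const))
  obtain ⟨C, hC⟩ := hQ.exists_bound_of_continuousOn hcont
  have hIoo : Ioo (ρ / 2) (2 * ρ) ∈ 𝓝 ρ := Ioo_mem_nhds (by linarith) (by linarith)
  have main := hasDerivAt_integral_of_dominated_loc_of_deriv_le (μ := volume) (𝕜 := ℝ)
    (F := fun r x => u x * k (r⁻¹ • (x - y))) (F' := F') (x₀ := ρ) (s := Ioo (ρ / 2) (2 * ρ))
    (bound := (closedBall y (2 * ρ)).indicator fun _ => C) hIoo
    (Eventually.of_forall fun r =>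
      (hu.mul (hks.continuous.comp (by fun_prop))).aestronglyMeasurable)
    (integrable_mul_scaled_kernel hu hks.continuous hk hρ)
    (hu.mul (continuous_const.mul (hE.comp (by fun_prop))).neg).aestronglyMeasurable
    (Eventually.of_forall fun x r hr => by
      by_cases hx : x ∈ closedBall y (2 * ρ)
      · rw [indicator_of_mem hx]
        exact hC (r, x) ⟨⟨hr.1.le, hr.2.le⟩, hx⟩
      · rw [indicator_of_notMem hx]
        have hr0 : 0 < r := by linarith [hr.1]
        have : euler k (r⁻¹ • (x - y)) = 0 := by
          refine euler_eq_zero hk ?_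
          rw [mem_closedBall, dist_eq_norm, not_le] at hx
          rw [norm_smul, Real.norm_of_nonneg (by positivity), inv_mul_eq_div, one_lt_div hr0]
          linarith [hr.2]
        simp [F', this])
    ((integrable_indicator_iff measurableSet_closedBall).2
      (integrableOn_const (isCompact_closedBall _ _).measure_lt_top.ne))
    (Eventually.of_forall fun x r hr => by
      have hr0 : r ≠ 0 := by linarith [hr.1]
      exact (hasDerivAt_scaled_kernel hks (x - y) hr0).const_mul (u x))
  have hpow : HasDerivAt (fun r : ℝ => (r ^ m)⁻¹) (-(m * (ρ ^ (m + 1))⁻¹)) ρ := by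
    have := (hasDerivAt_pow m ρ).inv (pow_ne_zero m hρ.ne')
    refine this.congr_deriv ?_
    rcases m with _ | m
    · simp
    · simp only [Nat.add_sub_cancel]
      field_simp
      ring
  refine (hpow.mul main.2).congr_deriv ?_
  have hi1 : Integrable (fun x => u x * k (ρ⁻¹ • (x - y))) :=
    integrable_mul_scaled_kernel hu hks.continuous hk hρ
  have e1 : ∫ x, F' ρ x = ∫ x, -ρ⁻¹ * (u x * euler k (ρ⁻¹ • (x - y))) := by
    congr 1; funext x; simp only [F']; ring
  have hi2 : Integrable (fun x => u x * euler k (ρ⁻¹ • (x - y))) := by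
    have := main.1.const_mul (-ρ)
    refine this.congr (Eventually.of_forall fun x => ?_)
    simp only [F']
    field_simp
  have e2 : ∫ x, u x * (m * k (ρ⁻¹ • (x - y)) + euler k (ρ⁻¹ • (x - y)))
      = m * (∫ x, u x * k (ρ⁻¹ • (x - y))) + ∫ x, u x * euler k (ρ⁻¹ • (x - y)) := by
    rw [← integral_const_mul, ← integral_add (hi1.const_mul _) hi2]
    congr 1; funext x; ring
  rw [e1, integral_const_mul, e2]
  field_simp
  ring

end Average

section Class

variable {N : ℕ} {z y : EuclideanSpace ℝ (Fin N)} {M ρ : ℝ} {Ω : Set (EuclideanSpace ℝ (Fin N))}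
  {u ζ k : EuclideanSpace ℝ (Fin N) → ℝ}

lemma MemP.hasDerivAt_avg (hu : MemP N 1 z M Ω u) {m : ℕ} (hk : KernelPair m ζ k)
    (hρ : 0 < ρ) (hy : closedBall y ρ ⊆ ball z 1) :
    HasDerivAt (avg m k u y) (ρ * (ρ ^ m)⁻¹ * ∫ x in Ω, ζ (ρ⁻¹ • (x - y))) ρ := by
  have h1 := hasDerivAt_avg_aux m hu.2.1.continuous hk.smooth_right hk.support_right y hρ
  have h2 := hu.2.2.1 (fun x => ζ (ρ⁻¹ • (x - y))) (contDiff_scaled_kernel hk.smooth_left _ _)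
    ((tsupport_scaled_kernel hk.support_left hρ).trans hy)
  refine h1.congr_deriv ?_
  rw [← h2]
  have : ∀ x, u x * lap N (fun x => ζ (ρ⁻¹ • (x - y))) x
      = -(ρ⁻¹ ^ 2) * (u x * (m * k (ρ⁻¹ • (x - y)) + euler k (ρ⁻¹ • (x - y)))) := fun x => by
    rw [lap_scaled hk.smooth_left, hk.lap_eq]; ring
  simp_rw [this]
  rw [integral_const_mul]
  generalize ∫ x, u x * (m * k (ρ⁻¹ • (x - y)) + euler k (ρ⁻¹ • (x - y))) = I
  field_simp
  ring

end Class

section Estimates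

variable {N : ℕ} {f g k u ψ η : EuclideanSpace ℝ (Fin N) → ℝ} {x y z : EuclideanSpace ℝ (Fin N)}
  {ρ : ℝ}

lemma integral_scaled (f : EuclideanSpace ℝ (Fin N) → ℝ) (y : EuclideanSpace ℝ (Fin N))
    (hρ : 0 < ρ) : ∫ x, f (ρ⁻¹ • (x - y)) = ρ ^ N * ∫ x, f x := by
  rw [integral_sub_right_eq_self (fun x => f (ρ⁻¹ • x)) y,
    Measure.integral_comp_inv_smul_of_nonneg _ _ hρ.le]
  simp

lemma avg_mono (hη : RadialPair ψ η) (hf : Continuous f) (hg : Continuous g) (hρ : 0 < ρ)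
    (h : ∀ x ∈ closedBall y ρ, f x ≤ g x) : avg N η f y ρ ≤ avg N η g y ρ := by
  refine mul_le_mul_of_nonneg_left ?_ (by positivity)
  refine integral_mono
    (integrable_mul_scaled_kernel hf hη.smooth_right.continuous hη.support_right hρ)
    (integrable_mul_scaled_kernel hg hη.smooth_right.continuous hη.support_right hρ) fun x => ?_
  by_cases hx : x ∈ closedBall y ρ
  · exact mul_le_mul_of_nonneg_right (h x hx) (hη.nonneg_right _)
  · simp [scaled_kernel_eq_zero hη.support_right hρ hx]

lemma avg_const (hη : RadialPair ψ η) (c : ℝ) (hρ : 0 < ρ) :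
    avg N η (fun _ => c) y ρ = c := by
  rw [avg, integral_const_mul, integral_scaled η y hρ, hη.integral_right]
  field_simp

lemma tendsto_avg (hη : RadialPair ψ η) (hg : Continuous g) (y : EuclideanSpace ℝ (Fin N)) :
    Tendsto (avg N η g y) (𝓝[>] 0) (𝓝 (g y)) := by
  rw [Metric.tendsto_nhds]
  intro ε hε
  obtain ⟨δ, hδ, hgδ⟩ := Metric.continuous_iff.1 hg y (ε / 2) (by positivity)
  filter_upwards [Ioo_mem_nhdsGT hδ] with ρ hρ
  have hb : ∀ x ∈ closedBall y ρ, |g x - g y| ≤ ε / 2 := fun x hx => by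
    have := hgδ x (lt_of_le_of_lt (mem_closedBall.1 hx) hρ.2)
    rw [Real.dist_eq] at this
    exact this.le
  have h1 := avg_mono (y := y) hη hg continuous_const hρ.1
    (fun x hx => show g x ≤ g y + ε / 2 by linarith [(abs_le.1 (hb x hx)).2])
  have h2 := avg_mono (y := y) hη continuous_const hg hρ.1
    (fun x hx => show g y - ε / 2 ≤ g x by linarith [(abs_le.1 (hb x hx)).1])
  rw [avg_const hη _ hρ.1] at h1 h2
  rw [Real.dist_eq, abs_lt]
  constructor <;> linarith

lemma continuous_dirDeriv (hu : ContDiff ℝ 1 u) (a : EuclideanSpace ℝ (Fin N)) :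
    Continuous (dirDeriv a u) :=
  (hu.continuous_fderiv (by simp)).clm_apply continuous_const

lemma integrable_scaled (hk : Continuous k) (hks : tsupport k ⊆ closedBall 0 1) (hρ : 0 < ρ) :
    Integrable (fun x => k (ρ⁻¹ • (x - y))) := by
  simpa using integrable_mul_scaled_kernel (u := fun _ => 1) (y := y) continuous_const hk hks hρ

lemma avg_dirDeriv (hu : ContDiff ℝ 1 u) (hk : ContDiff ℝ (⊤ : ℕ∞) k)
    (hks : tsupport k ⊆ closedBall 0 1) (a y : EuclideanSpace ℝ (Fin N)) (m : ℕ) (hρ : 0 < ρ) :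
    avg (m + 1) (dirDeriv a k) u y ρ = -avg m k (dirDeriv a u) y ρ := by
  have hka := (tsupport_dirDeriv_subset a).trans hks
  have hd : ∀ x, fderiv ℝ (fun x => k (ρ⁻¹ • (x - y))) x a
      = ρ⁻¹ * dirDeriv a k (ρ⁻¹ • (x - y)) := fun x =>
    congrFun (dirDeriv_scaled hk ρ⁻¹ y a) x
  have h := integral_mul_fderiv_eq_neg_fderiv_mul_of_integrable (μ := volume) (v := a)
    (f := u) (g := fun x => k (ρ⁻¹ • (x - y)))
    (integrable_mul_scaled_kernel (continuous_dirDeriv hu a) hk.continuous hks hρ)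
    (by
      simp_rw [hd]
      refine ((integrable_mul_scaled_kernel (y := y) hu.continuous
        (hk.dirDeriv a).continuous hka hρ).const_mul ρ⁻¹).congr (Eventually.of_forall fun x => ?_)
      ring)
    (integrable_mul_scaled_kernel hu.continuous hk.continuous hks hρ)
    (fun x _ => hu.differentiable (by simp) x)
    (fun x _ => (contDiff_scaled_kernel hk _ _).differentiable_of_top x)
  simp_rw [hd] at h
  have h3 : ∫ x, u x * (ρ⁻¹ * dirDeriv a k (ρ⁻¹ • (x - y)))
      = ρ⁻¹ * ∫ x, u x * dirDeriv a k (ρ⁻¹ • (x - y)) := by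
    rw [← integral_const_mul]; congr 1; funext x; ring
  rw [h3] at h
  have h4 : ∫ x, u x * dirDeriv a k (ρ⁻¹ • (x - y))
      = ρ * -∫ x, dirDeriv a u x * k (ρ⁻¹ • (x - y)) := by
    rw [show (fun x => dirDeriv a u x * k (ρ⁻¹ • (x - y)))
      = fun x => (fderiv ℝ u x) a * k (ρ⁻¹ • (x - y)) from rfl, ← h]
    field_simp
  rw [avg, avg, h4]
  generalize ∫ x, dirDeriv a u x * k (ρ⁻¹ • (x - y)) = I
  field_simp
  ring

lemma integral_dirDeriv_eq_zero (hk : ContDiff ℝ (⊤ : ℕ∞) k)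
    (hks : tsupport k ⊆ closedBall 0 1) (a : EuclideanSpace ℝ (Fin N)) :
    ∫ x, dirDeriv a k x = 0 := by
  have hka := (tsupport_dirDeriv_subset a).trans hks
  have h1 : Integrable (fun x => fderiv ℝ k x a) :=
    (hk.dirDeriv a).continuous.integrable_of_hasCompactSupport (hasCompactSupport_kernel hka)
  have h2 : Integrable k :=
    hk.continuous.integrable_of_hasCompactSupport (hasCompactSupport_kernel hks)
  have := integral_mul_fderiv_eq_neg_fderiv_mul_of_integrable (μ := volume) (v := a)
    (f := fun _ => (1 : ℝ)) (g := k) (by simp) (by simpa using h1) (by simpa using h2)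
    (fun x _ => differentiableAt_const _) (fun x _ => hk.differentiable_of_top x)
  simpa [dirDeriv] using this

lemma exists_taylor_bound (hk : ContDiff ℝ (⊤ : ℕ∞) k) (hks : tsupport k ⊆ closedBall 0 1) :
    ∃ C : ℝ, 0 ≤ C ∧ ∀ p q, |k p - k q - fderiv ℝ k q (p - q)| ≤ C * ‖p - q‖ ^ 2 := by
  have hk' : ContDiff ℝ (⊤ : ℕ∞) (fderiv ℝ k) := hk.fderiv_right (m := (⊤ : ℕ∞)) (by simp)
  obtain ⟨C, hC⟩ := hk'.lipschitzWith_of_hasCompactSupport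
    ((hasCompactSupport_kernel hks).fderiv (𝕜 := ℝ)) (by simp)
  refine ⟨C, C.2, fun p q => ?_⟩
  have := (convex_segment q p).norm_image_sub_le_of_norm_hasFDerivWithin_le' (𝕜 := ℝ)
    (f := k) (f' := fderiv ℝ k) (φ := fderiv ℝ k q) (C := C * ‖p - q‖)
    (fun x _ => (hk.differentiable_of_top x).hasFDerivAt.hasFDerivWithinAt)
    (fun x hx => by
      refine (hC.norm_sub_le x q).trans (mul_le_mul_of_nonneg_left ?_ C.2)
      obtain ⟨t, ht, rfl⟩ := (segment_eq_image' ℝ q p) ▸ hx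
      rw [add_sub_cancel_left, norm_smul, Real.norm_of_nonneg ht.1]
      exact mul_le_of_le_one_left (norm_nonneg _) ht.2)
    (left_mem_segment ℝ q p) (right_mem_segment ℝ q p)
  rw [Real.norm_eq_abs] at this
  nlinarith [this]

/-- The second order Taylor remainder of a rescaled kernel under a change of centre. -/
def remainder (k : EuclideanSpace ℝ (Fin N) → ℝ) (x y : EuclideanSpace ℝ (Fin N)) (t : ℝ)
    (w : EuclideanSpace ℝ (Fin N)) : ℝ :=
  k (t⁻¹ • (w - x)) - k (t⁻¹ • (w - y)) + t⁻¹ * dirDeriv (x - y) k (t⁻¹ • (w - y))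

lemma abs_remainder_le {C t : ℝ} (ht : 0 < t)
    (hC : ∀ p q, |k p - k q - fderiv ℝ k q (p - q)| ≤ C * ‖p - q‖ ^ 2)
    (x y w : EuclideanSpace ℝ (Fin N)) :
    |remainder k x y t w| ≤ C * (‖x - y‖ / t) ^ 2 := by
  have h := hC (t⁻¹ • (w - x)) (t⁻¹ • (w - y))
  have e : t⁻¹ • (w - x) - t⁻¹ • (w - y) = -(t⁻¹ • (x - y)) := by
    rw [← smul_sub, ← smul_neg]; congr 1; abel
  rw [e, norm_neg, norm_smul, Real.norm_of_nonneg (by positivity), inv_mul_eq_div, map_neg,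
    map_smul, sub_neg_eq_add] at h
  exact h

lemma remainder_eq_zero {t : ℝ} (ht : 0 < t) (hks : tsupport k ⊆ closedBall 0 1)
    {w : EuclideanSpace ℝ (Fin N)} (hx : w ∉ closedBall x t) (hy : w ∉ closedBall y t) :
    remainder k x y t w = 0 := by
  simp [remainder, scaled_kernel_eq_zero hks ht hx, scaled_kernel_eq_zero hks ht hy,
    scaled_kernel_eq_zero ((tsupport_dirDeriv_subset (x - y)).trans hks) ht hy]

lemma volume_real_closedBall (x : EuclideanSpace ℝ (Fin N)) {t : ℝ} (ht : 0 ≤ t) :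
    volume.real (closedBall x t)
      = t ^ N * volume.real (ball (0 : EuclideanSpace ℝ (Fin N)) 1) := by
  rw [measureReal_def, measureReal_def, Measure.addHaar_closedBall _ _ ht, ENNReal.toReal_mul,
    ENNReal.toReal_ofReal (by positivity)]
  simp

lemma abs_setIntegral_le {h : EuclideanSpace ℝ (Fin N) → ℝ} {K t : ℝ} (ht : 0 ≤ t)
    (S : Set (EuclideanSpace ℝ (Fin N)))
    (hK : ∀ w ∈ closedBall x t ∪ closedBall y t, |h w| ≤ K)
    (h0 : ∀ w, w ∉ closedBall x t → w ∉ closedBall y t → h w = 0) :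
    |∫ w in S, h w| ≤
      K * (2 * (t ^ N * volume.real (ball (0 : EuclideanSpace ℝ (Fin N)) 1))) := by
  have hK0 : 0 ≤ K := (abs_nonneg _).trans (hK x (Or.inl (mem_closedBall_self ht)))
  have hm : MeasurableSet (closedBall x t ∪ closedBall y t) :=
    measurableSet_closedBall.union measurableSet_closedBall
  have hfin : volume (closedBall x t ∪ closedBall y t) < ⊤ :=
    ((isCompact_closedBall x t).union (isCompact_closedBall y t)).measure_lt_top
  have e : ∫ w in S, h w = ∫ w in (closedBall x t ∪ closedBall y t), h w ∂(volume.restrict S) := by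
    refine (setIntegral_eq_integral_of_forall_compl_eq_zero fun w hw => ?_).symm
    rw [mem_union, not_or] at hw
    exact h0 w hw.1 hw.2
  have hle : (volume.restrict S) (closedBall x t ∪ closedBall y t)
      ≤ volume (closedBall x t ∪ closedBall y t) := Measure.restrict_apply_le _ _
  have h1 := norm_setIntegral_le_of_norm_le_const (μ := volume.restrict S)
    (s := closedBall x t ∪ closedBall y t) (C := K) (f := h)
    (hle.trans_lt hfin) (fun w hw => by rw [Real.norm_eq_abs]; exact hK w hw)
  rw [e]
  refine h1.trans (mul_le_mul_of_nonneg_left ?_ hK0)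
  calc (volume.restrict S).real (closedBall x t ∪ closedBall y t)
      ≤ volume.real (closedBall x t ∪ closedBall y t) := ENNReal.toReal_mono hfin.ne hle
    _ ≤ volume.real (closedBall x t) + volume.real (closedBall y t) := measureReal_union_le _ _
    _ = _ := by rw [volume_real_closedBall _ ht, volume_real_closedBall _ ht]; ring

end Estimates

section Geometry

variable {N : ℕ}

lemma exists_norm_one_apply_eq_norm {A : EuclideanSpace ℝ (Fin N) →L[ℝ] ℝ} (hA : A ≠ 0) :
    ∃ e : EuclideanSpace ℝ (Fin N), ‖e‖ = 1 ∧ A e = ‖A‖ := by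
  set v := (InnerProductSpace.toDual ℝ (EuclideanSpace ℝ (Fin N))).symm A with hv
  have hn : ‖v‖ = ‖A‖ := LinearIsometryEquiv.norm_map _ _
  have hpos : 0 < ‖v‖ := by rw [hn]; exact norm_pos_iff.2 hA
  have hAv : A v = ‖v‖ * ‖v‖ := by
    rw [← InnerProductSpace.toDual_symm_apply (𝕜 := ℝ) (y := A), ← hv, real_inner_self_eq_norm_mul_norm]
  refine ⟨‖v‖⁻¹ • v, ?_, ?_⟩
  · rw [norm_smul, norm_inv, norm_norm, inv_mul_cancel₀ hpos.ne']
  · rw [map_smul, hAv, smul_eq_mul, ← hn]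
    field_simp

lemma volume_strip_le {A : EuclideanSpace ℝ (Fin N) →L[ℝ] ℝ} (hA : A ≠ 0) {n : ℕ} {l ρ : ℝ}
    (hl : 0 < l) (hρ : 0 < ρ) (hnl : 5 * n * l ≤ 1) (y : EuclideanSpace ℝ (Fin N)) :
    n * volume.real {w | w ∈ closedBall y (2 * ρ) ∧ |A (w - y)| ≤ 2 * l * ρ * ‖A‖}
      ≤ (3 * ρ) ^ N * volume.real (ball (0 : EuclideanSpace ℝ (Fin N)) 1) := by
  obtain ⟨e, he, hAe⟩ := exists_norm_one_apply_eq_norm hA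
  have hA0 : 0 < ‖A‖ := norm_pos_iff.2 hA
  set S := {w | w ∈ closedBall y (2 * ρ) ∧ |A (w - y)| ≤ 2 * l * ρ * ‖A‖} with hS
  have hSm : MeasurableSet S := by
    have hc : Continuous fun w => |A (w - y)| := by fun_prop
    exact (isClosed_closedBall.inter (isClosed_le hc continuous_const)).measurableSet
  let T : ℕ → Set (EuclideanSpace ℝ (Fin N)) :=
    fun i => (fun w => w + -((i * (5 * l * ρ)) • e)) ⁻¹' S
  have hTm : ∀ i, MeasurableSet (T i) := fun i => hSm.preimage (by fun_prop)
  have hT : ∀ i, volume.real (T i) = volume.real S := fun i => by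
    rw [measureReal_def, measureReal_def, measure_preimage_add_right]
  have hsub : (⋃ i ∈ Finset.range n, T i) ⊆ closedBall y (3 * ρ) := by
    refine iUnion₂_subset fun i hi w hw => ?_
    have h1 : ‖w + -((i * (5 * l * ρ)) • e) - y‖ ≤ 2 * ρ := by
      rw [← dist_eq_norm]; exact hw.1
    have h2 : ‖((i : ℝ) * (5 * l * ρ)) • e‖ ≤ ρ := by
      rw [norm_smul, he, mul_one, Real.norm_of_nonneg (by positivity)]
      have : (i : ℝ) ≤ n := by exact_mod_cast (Finset.mem_range.1 hi).le
      nlinarith [mul_le_mul_of_nonneg_right this (by positivity : 0 ≤ 5 * l * ρ)]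
    rw [mem_closedBall, dist_eq_norm]
    calc ‖w - y‖ = ‖(w + -((i * (5 * l * ρ)) • e) - y) + ((i : ℝ) * (5 * l * ρ)) • e‖ := by
          congr 1; abel
      _ ≤ 2 * ρ + ρ := (norm_add_le _ _).trans (add_le_add h1 h2)
      _ = 3 * ρ := by ring
  have hdisj : Pairwise (Function.onFun Disjoint T) := by
    have key : ∀ i j : ℕ, i < j → Disjoint (T i) (T j) := fun i j hij => by
      refine Set.disjoint_left.2 fun w hi hj => ?_
      have ei : ∀ i : ℕ, A (w + -((i * (5 * l * ρ)) • e) - y)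
          = A (w - y) - i * (5 * l * ρ) * ‖A‖ := fun i => by
        rw [← hAe, ← smul_eq_mul (_ * _) (A e), ← map_smul, ← map_sub]; congr 1; abel
      have hi' := (abs_le.1 (ei i ▸ hi.2)).2
      have hj' := (abs_le.1 (ei j ▸ hj.2)).1
      have hij' : (i : ℝ) + 1 ≤ j := by exact_mod_cast hij
      have h3 := mul_le_mul_of_nonneg_right hij' (by positivity : 0 ≤ 5 * l * ρ * ‖A‖)
      have h4 : 0 < l * ρ * ‖A‖ := by positivity
      nlinarith
    intro i j hij
    rcases lt_or_gt_of_ne hij with h | h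
    · exact key i j h
    · exact (key j i h).symm
  have hfin : volume (closedBall y (3 * ρ)) ≠ ⊤ := measure_closedBall_lt_top.ne
  calc n * volume.real S = ∑ i ∈ Finset.range n, volume.real (T i) := by simp [hT]
    _ = volume.real (⋃ i ∈ Finset.range n, T i) := by
        refine (measureReal_biUnion_finset (fun i _ j _ h => hdisj h) (fun i _ => hTm i)
          fun i hi => ?_).symm
        exact ((measure_mono ((subset_biUnion_of_mem
          (u := T) (Finset.mem_coe.2 hi)).trans hsub)).trans_lt hfin.lt_top).ne
    _ ≤ volume.real (closedBall y (3 * ρ)) := measureReal_mono hsub hfin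
    _ = _ := volume_real_closedBall y (by positivity)

lemma volume_mul_le_of_local {F S : Set (EuclideanSpace ℝ (Fin N))} (hF : MeasurableSet F)
    {δ : ℝ} (hS : ∀ x ∈ F, closedBall x δ ⊆ S) {c : ENNReal}
    (hc : ∀ x ∈ F, volume (F ∩ closedBall x (2 * δ)) ≤ c) :
    volume F * volume (closedBall (0 : EuclideanSpace ℝ (Fin N)) δ) ≤ c * volume S := by
  let P : Set (EuclideanSpace ℝ (Fin N) × EuclideanSpace ℝ (Fin N)) :=
    {p | p.2 ∈ F ∧ dist p.1 p.2 ≤ δ}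
  have hP : MeasurableSet P :=
    (hF.preimage measurable_snd).inter (isClosed_le continuous_dist continuous_const).measurableSet
  have h1 : (volume.prod volume) P
      = volume F * volume (closedBall (0 : EuclideanSpace ℝ (Fin N)) δ) := by
    rw [Measure.prod_apply_symm hP, mul_comm, ← lintegral_indicator_const hF]
    refine lintegral_congr fun x => ?_
    by_cases hx : x ∈ F
    · rw [indicator_of_mem hx, ← Measure.addHaar_closedBall_center volume x δ]
      congr 1; ext w; simp [P, hx]
    · rw [indicator_of_notMem hx]
      have : (fun w => (w, x)) ⁻¹' P = ∅ := by ext w; simp [P, hx]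
      rw [this, measure_empty]
  rw [← h1, Measure.prod_apply hP]
  refine le_trans (lintegral_mono fun w => ?_) (lintegral_indicator_const_le S c)
  have e : Prod.mk w ⁻¹' P = F ∩ closedBall w δ := by
    ext x; simp [P, dist_comm w x]
  rw [e]
  by_cases hw : (F ∩ closedBall w δ).Nonempty
  · obtain ⟨x, hxF, hxw⟩ := hw
    rw [indicator_of_mem (hS x hxF (mem_closedBall_comm.1 hxw))]
    refine (measure_mono (inter_subset_inter_right F ?_)).trans (hc x hxF)
    refine closedBall_subset_closedBall' ?_
    linarith [mem_closedBall'.1 hxw]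
  · rw [not_nonempty_iff_eq_empty.1 hw, measure_empty]
    exact zero_le

/-- Pointwise second order data `A y ρ` at the points `y` and scales `ρ`, which nearly vanishes
along `Λ` and which changes between scales only in proportion to the density of `Λ`. -/
structure ScaleField (Λ : Set (EuclideanSpace ℝ (Fin N))) (z : EuclideanSpace ℝ (Fin N))
    (A : EuclideanSpace ℝ (Fin N) → ℝ → EuclideanSpace ℝ (Fin N) →L[ℝ] ℝ) (D : ℝ) : Prop where
  pos : 0 < D
  measurable : MeasurableSet Λ
  mem : z ∈ Λ
  abs_apply_le : ∀ ⦃x y ρ⦄, x ∈ Λ → y ∈ Λ → dist x z < 1 / 2 → dist y z < 1 / 2 → 0 < ρ →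
    ρ ≤ 1 / 4 → dist x y ≤ ρ → |A y ρ (x - y)| ≤ D * ρ
  norm_sub_centre_le : ∀ ⦃x y ρ⦄, dist x z < 1 / 2 → dist y z < 1 / 2 → 0 < ρ → ρ ≤ 1 / 4 →
    dist x y ≤ 2 * ρ → ‖A x ρ - A y ρ‖ ≤ D
  norm_sub_scale_le : ∀ ⦃y σ ρ⦄, dist y z < 1 / 2 → 0 < σ → σ ≤ ρ → ρ ≤ 1 / 4 →
    ‖A y σ - A y ρ‖ ≤ D * (ρ / σ) ^ (N + 1) * (volume.real (Λ ∩ closedBall y ρ) / ρ ^ N)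
  norm_top_le : ‖A z (1 / 4)‖ ≤ D

namespace ScaleField

variable {Λ : Set (EuclideanSpace ℝ (Fin N))} {z : EuclideanSpace ℝ (Fin N)}
  {A : EuclideanSpace ℝ (Fin N) → ℝ → EuclideanSpace ℝ (Fin N) →L[ℝ] ℝ} {D : ℝ}

lemma volume_inter_le (Λ : Set (EuclideanSpace ℝ (Fin N))) (y : EuclideanSpace ℝ (Fin N)) {ρ : ℝ}
    (hρ : 0 < ρ) : volume.real (Λ ∩ closedBall y ρ)
      ≤ ρ ^ N * volume.real (ball (0 : EuclideanSpace ℝ (Fin N)) 1) := by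
  rw [← volume_real_closedBall y hρ.le]
  exact measureReal_mono inter_subset_right measure_closedBall_lt_top.ne

lemma density_le (hA : ScaleField Λ z A D) {n : ℕ} (hn : n = 2 * 6 ^ N) {l : ℝ}
    (hl : l * (8 * n) = 1) (j : ℕ) : ∀ ⦃y ρ⦄, y ∈ Λ → 0 < ρ → ρ ≤ 1 / 4 →
      (∀ y' ∈ Λ, dist y' y ≤ 2 * ρ → dist y' z < 1 / 2 ∧ ∀ i < j, D / l ≤ ‖A y' (ρ * l ^ i)‖) →
      volume.real (Λ ∩ closedBall y ρ)
        ≤ (1 / 2) ^ j * (ρ ^ N * volume.real (ball (0 : EuclideanSpace ℝ (Fin N)) 1)) := by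
  have hn1 : (1 : ℝ) ≤ n := by
    rw [hn]; push_cast
    have : (1 : ℝ) ≤ 6 ^ N := one_le_pow₀ (by norm_num)
    linarith
  have hl0 : 0 < l := by
    by_contra h
    push Not at h
    nlinarith
  have hl8 : l ≤ 1 / 8 := by nlinarith
  set ω := volume.real (ball (0 : EuclideanSpace ℝ (Fin N)) 1) with hω
  have hω0 : 0 < ω := 
    ENNReal.toReal_pos (measure_ball_pos volume 0 one_pos).ne' measure_ball_lt_top.ne
  induction j with
  | zero => intro y ρ _ hρ _ _; simpa using volume_inter_le Λ y hρ
  | succ j ih =>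
    intro y ρ hy hρ hρ4 h
    have hy0 := h y hy (by simp [hρ.le])
    have hAy : D / l ≤ ‖A y ρ‖ := by simpa using hy0.2 0 (Nat.succ_pos j)
    have hDl : D ≤ l * ‖A y ρ‖ := by
      rw [div_le_iff₀ hl0] at hAy; linarith
    have hA0 : A y ρ ≠ 0 := norm_pos_iff.1 (lt_of_lt_of_le (div_pos hA.pos hl0) hAy)
    set S := {w | w ∈ closedBall y (2 * ρ) ∧ |A y ρ (w - y)| ≤ 2 * l * ρ * ‖A y ρ‖} with hS
    have hSvol := volume_strip_le hA0 hl0 hρ (n := n) (by nlinarith) y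
    have hSfin : volume S ≠ ⊤ :=
      ((measure_mono fun w hw => hw.1).trans_lt measure_closedBall_lt_top).ne
    have hlρ : 0 < l * ρ := by positivity
    have hloc := volume_mul_le_of_local (F := Λ ∩ closedBall y ρ) (S := S) (δ := l * ρ / 2)
      (c := ENNReal.ofReal ((1 / 2) ^ j * ((l * ρ) ^ N * ω)))
      (hA.measurable.inter measurableSet_closedBall)
      (fun x hx w hw => by
        have hxy := mem_closedBall.1 hx.2
        have hwx := mem_closedBall.1 hw
        refine ⟨?_, ?_⟩
        · rw [mem_closedBall]
          nlinarith [dist_triangle w x y]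
        · have h1 := hA.abs_apply_le hx.1 hy (h x hx.1 (by linarith)).1 hy0.1 hρ hρ4 hxy
          have h2 : |A y ρ (w - x)| ≤ ‖A y ρ‖ * (l * ρ / 2) := by
            refine ((A y ρ).le_opNorm _).trans (mul_le_mul_of_nonneg_left ?_ (norm_nonneg _))
            rwa [← dist_eq_norm]
          have h3 : A y ρ (w - y) = A y ρ (w - x) + A y ρ (x - y) := by
            rw [← map_add]; congr 1; abel
          rw [h3]
          refine (abs_add_le _ _).trans ?_
          have : 0 < l * ρ * ‖A y ρ‖ := by positivity
          nlinarith [mul_le_mul_of_nonneg_right hDl hρ.le])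
      (fun x hx => by
        have hxy := mem_closedBall.1 hx.2
        rw [show 2 * (l * ρ / 2) = l * ρ by ring]
        refine (measure_mono (inter_subset_inter_left _ inter_subset_left)).trans ?_
        rw [← ENNReal.ofReal_toReal (a := volume (Λ ∩ closedBall x (l * ρ)))
          ((measure_mono inter_subset_right).trans_lt measure_closedBall_lt_top).ne]
        refine ENNReal.ofReal_le_ofReal (ih hx.1 hlρ (by nlinarith) fun y' hy' hd => ?_)
        have := h y' hy' (by nlinarith [dist_triangle y' x y])
        refine ⟨this.1, fun i hi => ?_⟩
        have h4 := this.2 (i + 1) (by omega)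
        rwa [pow_succ', ← mul_assoc, mul_comm ρ l] at h4)
    have hloc' := ENNReal.toReal_mono (ENNReal.mul_ne_top ENNReal.ofReal_ne_top hSfin) hloc
    rw [ENNReal.toReal_mul, ENNReal.toReal_mul, ENNReal.toReal_ofReal (by positivity)] at hloc'
    change volume.real (Λ ∩ closedBall y ρ) * volume.real (closedBall _ _)
      ≤ _ * volume.real S at hloc'
    rw [volume_real_closedBall _ (by positivity)] at hloc'
    have hn0 : (n : ℝ) = 2 * 6 ^ N := by rw [hn]; push_cast; ring
    have hB : 0 < (l * ρ / 2) ^ N * ω := by positivity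
    refine le_of_mul_le_mul_right ?_ hB
    refine hloc'.trans ?_
    have hSle : volume.real S ≤ (3 * ρ) ^ N * ω / n := by
      rw [le_div_iff₀ (by linarith), mul_comm]; exact hSvol
    refine (mul_le_mul_of_nonneg_left hSle (by positivity)).trans (le_of_eq ?_)
    rw [hn0]
    have h6 : (6 : ℝ) ^ N = 2 ^ N * 3 ^ N := by rw [← mul_pow]; norm_num
    simp only [h6, div_pow, mul_pow, one_pow, pow_succ]
    field_simp

end ScaleField

end Geometry

lemma sum_half_pow_le_four (k : ℕ) :
    ∑ i ∈ Finset.range k, ((1 / 2 : ℝ) ^ i + (1 / 2) ^ (k - i)) ≤ 4 := by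
  rw [Finset.sum_add_distrib]
  have h : ∑ i ∈ Finset.range k, (1 / 2 : ℝ) ^ (k - i) ≤ 2 := by
    refine le_trans ?_ (sum_geometric_two_le k)
    rw [← Finset.sum_range_reflect (fun i => (1 / 2 : ℝ) ^ i)]
    exact Finset.sum_le_sum fun i _ =>
      pow_le_pow_of_le_one (by norm_num) (by norm_num) (by omega)
  linarith [sum_geometric_two_le k]

lemma half_pow_add_two_mul_pow_le {l : ℝ} (hl0 : 0 ≤ l) (hl : l ≤ 1 / 8) {i j k : ℕ} (hj : j < i)
    (hk : i + j < k) : (1 / 2 : ℝ) ^ k + 2 * l ^ i ≤ (1 / 2) ^ (i + j) := by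
  have h1 : (1 / 2 : ℝ) ^ k ≤ (1 / 2) ^ (i + j + 1) :=
    pow_le_pow_of_le_one (by norm_num) (by norm_num) hk
  have h2 : l ^ i ≤ (1 / 2) ^ (i + j + 2) := by
    calc l ^ i ≤ (1 / 8) ^ i := pow_le_pow_left₀ hl0 hl i
      _ = (1 / 2) ^ (3 * i) := by rw [pow_mul]; norm_num
      _ ≤ _ := pow_le_pow_of_le_one (by norm_num) (by norm_num) (by omega)
  rw [pow_succ] at h1
  rw [pow_succ, pow_succ] at h2
  linarith

namespace ScaleField

variable {N : ℕ} {Λ : Set (EuclideanSpace ℝ (Fin N))} {z : EuclideanSpace ℝ (Fin N)}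
  {A : EuclideanSpace ℝ (Fin N) → ℝ → EuclideanSpace ℝ (Fin N) →L[ℝ] ℝ} {D : ℝ}

lemma norm_sub_step_le (hA : ScaleField Λ z A D) {l : ℝ} (hl0 : 0 < l) (hl1 : l ≤ 1)
    {y : EuclideanSpace ℝ (Fin N)} {ρ : ℝ} (hy : dist y z < 1 / 2) (hρ : 0 < ρ) (hρ4 : ρ ≤ 1 / 4) :
    ‖A y (ρ * l) - A y ρ‖ ≤ D * l⁻¹ ^ (N + 1) * (volume.real (Λ ∩ closedBall y ρ) / ρ ^ N) := by
  have := hA.norm_sub_scale_le hy (mul_pos hρ hl0) (mul_le_of_le_one_right hρ.le hl1) hρ4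
  rwa [show ρ / (ρ * l) = l⁻¹ by field_simp] at this

lemma norm_sub_le (hA : ScaleField Λ z A D) {n : ℕ} (hn : n = 2 * 6 ^ N) {l : ℝ} (hl0 : 0 < l)
    (hl8 : l ≤ 1 / 8) (hl : l * (8 * n) = 1) {r H : ℝ} (hr : 0 < r) (hr16 : r ≤ 1 / 16)
    (hH : H = D + 4 * (D * l⁻¹ ^ (N + 1) * volume.real (ball (0 : EuclideanSpace ℝ (Fin N)) 1)))
    (hbig : D / l + H ≤ ‖A z r‖) (k : ℕ) :
    ∀ y ∈ Λ, dist y z ≤ r * (1 + (1 / 2) ^ k) → ‖A y (r * l ^ k) - A z r‖ ≤ H := by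
  set ω := volume.real (ball (0 : EuclideanSpace ℝ (Fin N)) 1) with hω
  have hω0 : 0 ≤ ω := measureReal_nonneg
  have hD := hA.pos
  induction k using Nat.strong_induction_on with
  | _ k ih =>
    intro y hy hyz
    have hyz2 : dist y z ≤ 2 * r := by
      have : (1 / 2 : ℝ) ^ k ≤ 1 := pow_le_one₀ (by norm_num) (by norm_num)
      nlinarith
    have h0 : ‖A y r - A z r‖ ≤ D :=
      hA.norm_sub_centre_le (by linarith) (by simp) hr (by linarith) hyz2
    have hli : ∀ i : ℕ, l ^ i ≤ 1 := fun i => pow_le_one₀ hl0.le (by linarith)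
    have hterm : ∀ i ∈ Finset.range k, dist (A y (r * l ^ i)) (A y (r * l ^ (i + 1)))
        ≤ D * l⁻¹ ^ (N + 1) * ω * ((1 / 2) ^ i + (1 / 2) ^ (k - i)) := by
      intro i hi
      have hik := Finset.mem_range.1 hi
      have hri : 0 < r * l ^ i := by positivity
      have hri' : r * l ^ i ≤ r := mul_le_of_le_one_right hr.le (hli i)
      have hstep := hA.norm_sub_step_le hl0 (by linarith) (y := y) (ρ := r * l ^ i)
        (by linarith) hri (by linarith)
      have hdens := hA.density_le hn hl (min i (k - i)) hy hri (by linarith) (by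
        intro y' hy' hd
        refine ⟨by linarith [dist_triangle y' y z], fun j hj => ?_⟩
        have hj1 : j < i := lt_of_lt_of_le hj (min_le_left _ _)
        have hj2 : i + j < k := by
          have := lt_of_lt_of_le hj (min_le_right _ _)
          omega
        have h1 := ih (i + j) hj2 y' hy' (by
          have := half_pow_add_two_mul_pow_le hl0.le hl8 hj1 hj2
          nlinarith [dist_triangle y' y z])
        rw [mul_assoc, ← pow_add]
        have h2 := norm_sub_norm_le (A z r) (A y' (r * l ^ (i + j)))
        rw [norm_sub_rev] at h2
        linarith)
      rw [dist_comm, dist_eq_norm, pow_succ, ← mul_assoc, mul_assoc _ ω]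
      refine hstep.trans (mul_le_mul_of_nonneg_left ?_ (by positivity))
      rw [div_le_iff₀ (by positivity)]
      refine hdens.trans ?_
      have h3 : (1 / 2 : ℝ) ^ (min i (k - i)) ≤ (1 / 2) ^ i + (1 / 2) ^ (k - i) := by
        rcases min_choice i (k - i) with h | h <;> rw [h]
        · exact le_add_of_nonneg_right (by positivity)
        · exact le_add_of_nonneg_left (by positivity)
      calc (1 / 2 : ℝ) ^ (min i (k - i)) * ((r * l ^ i) ^ N * ω)
          ≤ ((1 / 2) ^ i + (1 / 2) ^ (k - i)) * ((r * l ^ i) ^ N * ω) :=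
            mul_le_mul_of_nonneg_right h3 (by positivity)
        _ = _ := by ring
    have hsum : ‖A y (r * l ^ k) - A y r‖ ≤ D * l⁻¹ ^ (N + 1) * ω * 4 := by
      have h1 := dist_le_range_sum_dist (fun i => A y (r * l ^ i)) k
      simp only [pow_zero, mul_one] at h1
      rw [dist_comm, dist_eq_norm] at h1
      refine h1.trans ((Finset.sum_le_sum hterm).trans ?_)
      rw [← Finset.mul_sum]
      exact mul_le_mul_of_nonneg_left (sum_half_pow_le_four k) (by positivity)
    rw [hH]
    linarith [norm_sub_le_norm_sub_add_norm_sub (A y (r * l ^ k)) (A y r) (A z r)]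

/-- The second order data of a scale field at its base point are bounded along a geometric
sequence of scales. -/
theorem exists_norm_le (N : ℕ) : ∃ l C : ℝ, 0 < l ∧ l ≤ 1 / 8 ∧ 0 < C ∧
    ∀ (Λ : Set (EuclideanSpace ℝ (Fin N))) (z : EuclideanSpace ℝ (Fin N))
      (A : EuclideanSpace ℝ (Fin N) → ℝ → EuclideanSpace ℝ (Fin N) →L[ℝ] ℝ) (D : ℝ),
      ScaleField Λ z A D → ∀ k : ℕ, ‖A z (1 / 4 * l ^ k)‖ ≤ C * D := by
  obtain ⟨n, hn⟩ : ∃ n : ℕ, n = 2 * 6 ^ N := ⟨_, rfl⟩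
  have hn1 : (1 : ℝ) ≤ n := by
    have : 0 < n := by rw [hn]; positivity
    exact_mod_cast this
  obtain ⟨l, hl⟩ : ∃ l : ℝ, l * (8 * n) = 1 := ⟨(8 * n)⁻¹, inv_mul_cancel₀ (by positivity)⟩
  have hl0 : 0 < l := pos_of_mul_pos_left (by rw [hl]; exact one_pos) (by positivity)
  have hl8 : l ≤ 1 / 8 := by nlinarith
  set ω := volume.real (ball (0 : EuclideanSpace ℝ (Fin N)) 1) with hω
  have hω0 : 0 ≤ ω := measureReal_nonneg
  set K := l⁻¹ ^ (N + 1) with hK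
  have hK0 : 0 ≤ K := by positivity
  refine ⟨l, 1 / l + (1 + 4 * (K * ω)) + K * ω + (1 + 4 * (K * ω)), hl0, hl8, by positivity,
    fun Λ z A D hA => ?_⟩
  have hD := hA.pos
  set H := D + 4 * (D * K * ω) with hH
  have hC : (1 / l + (1 + 4 * (K * ω)) + K * ω + (1 + 4 * (K * ω))) * D
      = (D / l + H) + D * K * ω + H := by rw [hH]; ring
  rw [hC]
  have hH0 : 0 ≤ H := by positivity
  have hKω : 0 ≤ D * K * ω := by positivity
  by_cases hall : ∀ k : ℕ, ‖A z (1 / 4 * l ^ k)‖ < D / l + H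
  · intro k
    linarith [hall k]
  push Not at hall
  classical
  set m := Nat.find hall with hm
  have hm1 : D / l + H ≤ ‖A z (1 / 4 * l ^ m)‖ := Nat.find_spec hall
  have hmlt : ∀ k < m, ‖A z (1 / 4 * l ^ k)‖ < D / l + H := fun k hk =>
    not_le.1 (Nat.find_min hall hk)
  have hm0 : m ≠ 0 := by
    intro h0
    rw [h0, pow_zero, mul_one] at hm1
    have h1 : D < D / l := by rw [lt_div_iff₀ hl0]; nlinarith
    linarith [hA.norm_top_le]
  obtain ⟨p, hp⟩ := Nat.exists_eq_succ_of_ne_zero hm0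
  have hlp : l ^ p ≤ 1 := pow_le_one₀ hl0.le (by linarith)
  have hup : ‖A z (1 / 4 * l ^ m)‖ ≤ D / l + H + D * K * ω := by
    have h1 := hA.norm_sub_step_le hl0 (by linarith) (y := z) (ρ := 1 / 4 * l ^ p) (by simp)
      (by positivity) (by linarith)
    have h2 : volume.real (Λ ∩ closedBall z (1 / 4 * l ^ p)) / (1 / 4 * l ^ p) ^ N ≤ ω := by
      rw [div_le_iff₀ (by positivity), mul_comm ω]
      exact volume_inter_le Λ z (by positivity)
    have h3 := h1.trans (mul_le_mul_of_nonneg_left h2 (by positivity))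
    rw [mul_assoc (1 / 4), ← pow_succ, ← Nat.succ_eq_add_one, ← hp] at h3
    linarith [norm_sub_norm_le (A z (1 / 4 * l ^ m)) (A z (1 / 4 * l ^ p)),
      hmlt p (by omega)]
  intro k
  rcases lt_or_ge k m with hk | hk
  · linarith [hmlt k hk]
  · have hr16 : 1 / 4 * l ^ m ≤ 1 / 16 := by
      rw [hp, pow_succ]
      nlinarith
    have h1 := hA.norm_sub_le hn hl0 hl8 hl (r := 1 / 4 * l ^ m) (H := H) (by positivity) hr16 hH
      hm1 (k - m) z hA.mem (by rw [dist_self]; positivity)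
    rw [mul_assoc, ← pow_add, Nat.add_sub_cancel' hk] at h1
    linarith [norm_sub_norm_le (A z (1 / 4 * l ^ k)) (A z (1 / 4 * l ^ m))]

end ScaleField

lemma abs_le_add_div_of_abs_deriv_le {G G' : ℝ → ℝ} {ρ R c : ℝ} (hρ : 0 < ρ) (hR : ρ ≤ R)
    (hc : 0 ≤ c) (hG : ∀ t ∈ Icc ρ R, HasDerivAt G (G' t) t)
    (hb : ∀ t ∈ Icc ρ R, |G' t| ≤ c / t ^ 2) : |G ρ| ≤ |G R| + c / ρ := by
  have key : ∀ s : ℝ, |s| = 1 → s * G ρ ≤ s * G R + c / ρ := fun s hs => by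
    have hd : ∀ t ∈ Icc ρ R, HasDerivAt (fun t => s * G t - c * t⁻¹)
        (s * G' t - c * (-(t ^ 2)⁻¹)) t := fun t ht =>
      ((hG t ht).const_mul s).sub ((hasDerivAt_inv (hρ.trans_le ht.1).ne').const_mul c)
    have hmono : MonotoneOn (fun t => s * G t - c * t⁻¹) (Icc ρ R) := by
      refine monotoneOn_of_hasDerivWithinAt_nonneg (convex_Icc ρ R)
        (fun t ht => (hd t ht).continuousAt.continuousWithinAt)
        (fun t ht => (hd t (interior_subset ht)).hasDerivWithinAt) fun t ht => ?_
      have h1 := hb t (interior_subset ht)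
      have h2 : |s * G' t| ≤ c / t ^ 2 := by rwa [abs_mul, hs, one_mul]
      have h3 : c * (-(t ^ 2)⁻¹) = -(c / t ^ 2) := by ring
      rw [h3]
      linarith [(abs_le.1 h2).1]
    have h := hmono (left_mem_Icc.2 hR) (right_mem_Icc.2 hR) hR
    have h4 : 0 ≤ c * R⁻¹ := mul_nonneg hc (inv_nonneg.2 (hρ.le.trans hR))
    simp only at h
    rw [div_eq_mul_inv]
    linarith
  rw [abs_le]
  constructor
  · linarith [key (-1) (by simp), neg_abs_le (G R), le_abs_self (G R), neg_le_abs (G R)]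
  · linarith [key 1 (by simp), le_abs_self (G R)]

section Field

variable {N : ℕ} {ζ k u ψ η : EuclideanSpace ℝ (Fin N) → ℝ} {x y z : EuclideanSpace ℝ (Fin N)}
  {ρ M : ℝ} {Ω : Set (EuclideanSpace ℝ (Fin N))} {m : ℕ}

/-- The averaged second derivatives, as a continuous linear functional of one direction. -/
def hessAvg (k u : EuclideanSpace ℝ (Fin N) → ℝ) (y : EuclideanSpace ℝ (Fin N)) (ρ : ℝ) :
    EuclideanSpace ℝ (Fin N) →L[ℝ] ℝ :=
  (ρ ^ (N + 2))⁻¹ • ∫ x, u x • fderiv ℝ k (ρ⁻¹ • (x - y))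

lemma hessAvg_apply (hu : Continuous u) (hk : ContDiff ℝ (⊤ : ℕ∞) k)
    (hks : tsupport k ⊆ closedBall 0 1) (hρ : 0 < ρ) (b : EuclideanSpace ℝ (Fin N)) :
    hessAvg k u y ρ b = avg (N + 2) (dirDeriv b k) u y ρ := by
  have hc : Continuous fun x => u x • fderiv ℝ k (ρ⁻¹ • (x - y)) :=
    hu.smul ((hk.continuous_fderiv (by simp)).comp (by fun_prop))
  have hs : HasCompactSupport fun x => u x • fderiv ℝ k (ρ⁻¹ • (x - y)) := by
    refine HasCompactSupport.intro (isCompact_closedBall y ρ) fun x hx => ?_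
    have : fderiv ℝ k (ρ⁻¹ • (x - y)) = 0 := by
      ext b
      exact scaled_kernel_eq_zero ((tsupport_dirDeriv_subset b).trans hks) hρ hx
    rw [this, smul_zero]
  rw [hessAvg, _root_.smul_apply,
    ContinuousLinearMap.integral_apply (hc.integrable_of_hasCompactSupport hs)]
  rfl

lemma MemP.hasDerivAt_remainder (hu : MemP N 1 z M Ω u) (hk : KernelPair m ζ k) {t : ℝ} (ht : 0 < t)
    (hx : closedBall x t ⊆ ball z 1) (hy : closedBall y t ⊆ ball z 1) :
    HasDerivAt (fun t => avg m k u x t - avg m k u y t + avg (m + 1) (dirDeriv (x - y) k) u y t)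
      (t * (t ^ m)⁻¹ * ∫ w in Ω, remainder ζ x y t w) t := by
  have hkd := hk.directional (x - y)
  have i1 := (integrable_scaled (y := x) hk.smooth_left.continuous hk.support_left ht).restrict
    (s := Ω)
  have i2 := (integrable_scaled (y := y) hk.smooth_left.continuous hk.support_left ht).restrict
    (s := Ω)
  have i3 := ((integrable_scaled (y := y) hkd.smooth_left.continuous hkd.support_left
    ht).restrict (s := Ω)).const_mul t⁻¹
  refine (((hu.hasDerivAt_avg hk ht hx).sub (hu.hasDerivAt_avg hk ht hy)).add
    (hu.hasDerivAt_avg hkd ht hy)).congr_deriv ?_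
  have : ∫ w in Ω, remainder ζ x y t w
      = (∫ w in Ω, ζ (t⁻¹ • (w - x))) - (∫ w in Ω, ζ (t⁻¹ • (w - y)))
        + t⁻¹ * ∫ w in Ω, dirDeriv (x - y) ζ (t⁻¹ • (w - y)) := by
    rw [← integral_const_mul, ← integral_sub i1 i2]
    exact integral_add (i1.sub i2) i3
  rw [this]
  generalize ∫ w in Ω, ζ (t⁻¹ • (w - x)) = I1
  generalize ∫ w in Ω, ζ (t⁻¹ • (w - y)) = I2
  generalize ∫ w in Ω, dirDeriv (x - y) ζ (t⁻¹ • (w - y)) = I3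
  field_simp
  ring

lemma avg_remainder_eq (hu : Continuous u) (hk : ContDiff ℝ (⊤ : ℕ∞) k)
    (hks : tsupport k ⊆ closedBall 0 1) {t : ℝ} (ht : 0 < t) :
    avg m k u x t - avg m k u y t + avg (m + 1) (dirDeriv (x - y) k) u y t
      = (t ^ m)⁻¹ * ∫ w, u w * remainder k x y t w := by
  have hkd := (tsupport_dirDeriv_subset (x - y)).trans hks
  have i1 := integrable_mul_scaled_kernel (y := x) hu hk.continuous hks ht
  have i2 := integrable_mul_scaled_kernel (y := y) hu hk.continuous hks ht
  have i3 := (integrable_mul_scaled_kernel (y := y) hu (hk.dirDeriv (x - y)).continuous hkd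
    ht).const_mul t⁻¹
  have : ∫ w, u w * remainder k x y t w
      = (∫ w, u w * k (t⁻¹ • (w - x))) - (∫ w, u w * k (t⁻¹ • (w - y)))
        + t⁻¹ * ∫ w, u w * dirDeriv (x - y) k (t⁻¹ • (w - y)) := by
    rw [← integral_const_mul, ← integral_sub i1 i2]
    refine Eq.trans ?_ (integral_add (i1.sub i2) i3)
    congr 1; funext w
    simp only [remainder]
    ring
  rw [this, avg, avg, avg]
  generalize ∫ w, u w * k (t⁻¹ • (w - x)) = I1
  generalize ∫ w, u w * k (t⁻¹ • (w - y)) = I2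
  generalize ∫ w, u w * dirDeriv (x - y) k (t⁻¹ • (w - y)) = I3
  field_simp
  ring

lemma closedBall_subset_ball_of_dist {r : ℝ} (h : dist y z + r < 1) :
    closedBall y r ⊆ ball z 1 := fun w hw => by
  rw [mem_ball]
  linarith [dist_triangle w y z, mem_closedBall.1 hw]

lemma MemP.abs_avg_add_le (hu : MemP N 1 z M Ω u) (hP : RadialPair ψ η)
    (a : EuclideanSpace ℝ (Fin N)) (hρ : 0 < ρ) (hy : closedBall y ρ ⊆ ball z 1) :
    |avg (N + 1) (dirDeriv a η) u y ρ + dirDeriv a u y| ≤ (∫ x, |dirDeriv a ψ x|) * ρ := by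
  have hk := hP.kernelPair.directional a
  have hI : 0 ≤ ∫ x, |dirDeriv a ψ x| := integral_nonneg fun _ => abs_nonneg _
  have hd : ∀ t : ℝ, 0 < t →
      |t * (t ^ (N + 1))⁻¹ * ∫ x in Ω, dirDeriv a ψ (t⁻¹ • (x - y))|
        ≤ ∫ x, |dirDeriv a ψ x| := fun t ht => by
    have h1 : |∫ x in Ω, dirDeriv a ψ (t⁻¹ • (x - y))| ≤ t ^ N * ∫ x, |dirDeriv a ψ x| := by
      rw [← integral_scaled (fun x => |dirDeriv a ψ x|) y ht]
      exact abs_integral_le_integral_abs.trans (setIntegral_le_integral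
        (integrable_scaled hk.smooth_left.continuous hk.support_left ht).abs
        (Eventually.of_forall fun _ => abs_nonneg _))
    rw [abs_mul, abs_of_nonneg (by positivity : 0 ≤ t * (t ^ (N + 1))⁻¹)]
    refine (mul_le_mul_of_nonneg_left h1 (by positivity)).trans (le_of_eq ?_)
    field_simp
    ring
  have hσ : ∀ σ ∈ Ioo 0 ρ, |avg (N + 1) (dirDeriv a η) u y ρ + avg N η (dirDeriv a u) y σ|
      ≤ (∫ x, |dirDeriv a ψ x|) * ρ := fun σ hσ => by
    have h := (convex_Icc σ ρ).norm_image_sub_le_of_norm_hasDerivWithin_le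
      (f := avg (N + 1) (dirDeriv a η) u y) (x := σ) (y := ρ)
      (fun t ht => (hu.hasDerivAt_avg hk (hσ.1.trans_le ht.1)
        ((closedBall_subset_closedBall ht.2).trans hy)).hasDerivWithinAt)
      (fun t ht => hd t (hσ.1.trans_le ht.1)) (left_mem_Icc.2 hσ.2.le) (right_mem_Icc.2 hσ.2.le)
    have e := avg_dirDeriv hu.2.1 hP.smooth_right hP.support_right a y N hσ.1
    rw [e, sub_neg_eq_add, Real.norm_eq_abs, Real.norm_of_nonneg (by linarith [hσ.2])] at h
    exact h.trans (mul_le_mul_of_nonneg_left (by linarith [hσ.1]) hI)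
  refine le_of_tendsto (((tendsto_avg hP (continuous_dirDeriv hu.2.1 a) y).const_add _).abs) ?_
  filter_upwards [Ioo_mem_nhdsGT hρ] with σ h
  exact hσ σ h

lemma MemP.abs_sub_hessAvg_le (hu : MemP N 1 z M Ω u) (hP : RadialPair ψ η)
    (a : EuclideanSpace ℝ (Fin N)) {C C' : ℝ}
    (hC : ∀ p q, |dirDeriv a ψ p - dirDeriv a ψ q - fderiv ℝ (dirDeriv a ψ) q (p - q)|
      ≤ C * ‖p - q‖ ^ 2)
    (hC' : ∀ p q, |dirDeriv a η p - dirDeriv a η q - fderiv ℝ (dirDeriv a η) q (p - q)|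
      ≤ C' * ‖p - q‖ ^ 2) (hC0 : 0 ≤ C) (hC0' : 0 ≤ C') (hM : 0 ≤ M)
    (hx : dist x z < 3 / 4) (hy : dist y z < 3 / 4) (hρ : 0 < ρ) (hρ4 : ρ ≤ 1 / 4)
    (hxy : dist x y ≤ 3 * ρ) :
    |dirDeriv a u x - dirDeriv a u y - hessAvg (dirDeriv a η) u y ρ (x - y)|
      ≤ (2 * (∫ x, |dirDeriv a ψ x|)
          + 18 * C * volume.real (ball (0 : EuclideanSpace ℝ (Fin N)) 1)
          + 1152 * C' * volume.real (ball (0 : EuclideanSpace ℝ (Fin N)) 1) * M) * ρ := by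
  set ω := volume.real (ball (0 : EuclideanSpace ℝ (Fin N)) 1) with hω
  have hω0 : 0 ≤ ω := measureReal_nonneg
  have hk := hP.kernelPair.directional a
  set f := dirDeriv a ψ
  set k := dirDeriv a η
  have hxs : ∀ t ≤ (1 / 4 : ℝ), closedBall x t ⊆ ball z 1 := fun t ht =>
    closedBall_subset_ball_of_dist (by linarith)
  have hys : ∀ t ≤ (1 / 4 : ℝ), closedBall y t ⊆ ball z 1 := fun t ht =>
    closedBall_subset_ball_of_dist (by linarith)
  have hd0 : 0 ≤ ‖x - y‖ := norm_nonneg _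
  have hd : ‖x - y‖ ^ 2 ≤ 9 * ρ ^ 2 := by
    rw [dist_eq_norm] at hxy
    nlinarith
  set G : ℝ → ℝ := fun t => avg (N + 1) k u x t - avg (N + 1) k u y t
    + avg (N + 1 + 1) (dirDeriv (x - y) k) u y t with hG
  have hG' := abs_le_add_div_of_abs_deriv_le (G := G)
    (G' := fun t => t * (t ^ (N + 1))⁻¹ * ∫ w in Ω, remainder f x y t w)
    (c := 2 * ω * C * ‖x - y‖ ^ 2) hρ hρ4 (by positivity)
    (fun t ht => hu.hasDerivAt_remainder hk (hρ.trans_le ht.1) (hxs t ht.2) (hys t ht.2))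
    (fun t ht => by
      have ht0 := hρ.trans_le ht.1
      have h1 := abs_setIntegral_le (x := x) (y := y) ht0.le Ω
        (fun w _ => abs_remainder_le ht0 hC x y w)
        (fun w h1 h2 => remainder_eq_zero ht0 hk.support_left h1 h2)
      simp only [abs_mul, abs_of_nonneg (by positivity : 0 ≤ t * (t ^ (N + 1))⁻¹)]
      refine (mul_le_mul_of_nonneg_left h1 (by positivity)).trans (le_of_eq ?_)
      rw [← hω, pow_succ t N]
      field_simp)
  have hG4 : |G (1 / 4)| ≤ 128 * ω * C' * M * ‖x - y‖ ^ 2 := by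
    have ht0 : (0 : ℝ) < 1 / 4 := by norm_num
    have h1 := abs_setIntegral_le (x := x) (y := y) (K := M * (C' * (‖x - y‖ / (1 / 4)) ^ 2))
      (h := fun w => u w * remainder k x y (1 / 4) w) ht0.le univ
      (fun w hw => by
        rw [abs_mul]
        refine mul_le_mul (hu.2.2.2.2.1 w ?_) (abs_remainder_le ht0 hC' x y w) (abs_nonneg _) hM
        exact hw.elim (fun h => hxs _ le_rfl h) (fun h => hys _ le_rfl h))
      (fun w h1 h2 => by rw [remainder_eq_zero ht0 hk.support_right h1 h2, mul_zero])
    rw [setIntegral_univ] at h1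
    simp only [hG]
    rw [avg_remainder_eq hu.2.1.continuous hk.smooth_right hk.support_right ht0, abs_mul,
      abs_of_nonneg (by positivity : (0 : ℝ) ≤ ((1 / 4) ^ (N + 1))⁻¹)]
    refine (mul_le_mul_of_nonneg_left h1 (by positivity)).trans (le_of_eq ?_)
    rw [← hω, pow_succ]
    field_simp
    ring
  have hGρ : |G ρ| ≤ (18 * C * ω + 1152 * C' * ω * M) * ρ := by
    have h1 : 2 * ω * C * ‖x - y‖ ^ 2 / ρ ≤ 18 * C * ω * ρ := by
      rw [div_le_iff₀ hρ]
      nlinarith [mul_le_mul_of_nonneg_left hd (by positivity : 0 ≤ 2 * ω * C)]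
    have h2 : 128 * ω * C' * M * ‖x - y‖ ^ 2 ≤ 1152 * C' * ω * M * ρ := by
      have := mul_le_mul_of_nonneg_left hd (by positivity : 0 ≤ 128 * ω * C' * M)
      have h3 : ρ ^ 2 ≤ ρ := by nlinarith
      nlinarith [mul_le_mul_of_nonneg_left h3 (by positivity : 0 ≤ 1152 * C' * ω * M)]
    linarith
  have h1 := hu.abs_avg_add_le hP a hρ (hxs ρ hρ4)
  have h2 := hu.abs_avg_add_le hP a hρ (hys ρ hρ4)
  have e : dirDeriv a u x - dirDeriv a u y - hessAvg k u y ρ (x - y)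
      = (avg (N + 1) k u x ρ + dirDeriv a u x) - (avg (N + 1) k u y ρ + dirDeriv a u y) - G ρ := by
    rw [hessAvg_apply hu.2.1.continuous hk.smooth_right hk.support_right hρ]
    simp only [hG]
    ring
  rw [e]
  refine (abs_sub _ _).trans ((add_le_add (abs_sub _ _) hGρ).trans ?_)
  linarith

end Field

section Field

variable {N : ℕ} {ζ k u ψ η : EuclideanSpace ℝ (Fin N) → ℝ} {x y z : EuclideanSpace ℝ (Fin N)}
  {ρ M : ℝ} {Ω : Set (EuclideanSpace ℝ (Fin N))} {m : ℕ}

lemma norm_sub_le_of_affine_approx {g : EuclideanSpace ℝ (Fin N) → ℝ}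
    {P Q : EuclideanSpace ℝ (Fin N) →L[ℝ] ℝ} {K : ℝ} (hK : 0 ≤ K) (hρ : 0 < ρ)
    (hP : ∀ v, ‖v‖ = ρ → |g (x + v) - g x - P v| ≤ K * ρ)
    (hQ : ∀ v, ‖v‖ = ρ → |g (x + v) - g y - Q (x + v - y)| ≤ K * ρ)
    (hxy : |g x - g y - Q (x - y)| ≤ K * ρ) : ‖P - Q‖ ≤ 3 * K := by
  refine ContinuousLinearMap.opNorm_le_bound _ (by positivity) fun v => ?_
  rcases eq_or_ne v 0 with rfl | hv
  · simp
  have hv0 : 0 < ‖v‖ := norm_pos_iff.2 hv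
  set w := (ρ / ‖v‖) • v with hw
  have hwn : ‖w‖ = ρ := by
    rw [hw, norm_smul, Real.norm_of_nonneg (by positivity)]
    field_simp
  have e : (P - Q) w = (g (x + w) - g y - Q (x + w - y)) - (g (x + w) - g x - P w)
      - (g x - g y - Q (x - y)) := by
    rw [show x + w - y = (x - y) + w by abel, map_add, sub_apply]
    ring
  have h1 : |(P - Q) w| ≤ 3 * K * ρ := by
    rw [e]
    refine (abs_sub _ _).trans ((add_le_add (abs_sub _ _) hxy).trans ?_)
    linarith [hP w hwn, hQ w hwn]
  rw [hw, map_smul, smul_eq_mul, abs_mul, abs_of_pos (by positivity : 0 < ρ / ‖v‖), div_mul_eq_mul_div,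
    div_le_iff₀ hv0] at h1
  rw [Real.norm_eq_abs]
  refine le_of_mul_le_mul_left ?_ hρ
  linarith

lemma exists_fderiv_bound (hk : ContDiff ℝ (⊤ : ℕ∞) k) (hks : tsupport k ⊆ closedBall 0 1) :
    ∃ K : ℝ, 0 ≤ K ∧ ∀ p, ‖fderiv ℝ k p‖ ≤ K := by
  obtain ⟨K, hK⟩ := ((hasCompactSupport_kernel hks).fderiv (𝕜 := ℝ)).exists_bound_of_continuous
    (hk.continuous_fderiv (by simp))
  exact ⟨K, (norm_nonneg _).trans (hK 0), hK⟩

lemma norm_hessAvg_le {K : ℝ} (hu : Continuous u) (hk : ContDiff ℝ (⊤ : ℕ∞) k)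
    (hks : tsupport k ⊆ closedBall 0 1) (hK0 : 0 ≤ K) (hK : ∀ p, ‖fderiv ℝ k p‖ ≤ K)
    (hM : 0 ≤ M) (hρ : 0 < ρ) (huM : ∀ x ∈ closedBall y ρ, |u x| ≤ M) :
    ‖hessAvg k u y ρ‖
      ≤ 2 * M * K * volume.real (ball (0 : EuclideanSpace ℝ (Fin N)) 1) / ρ ^ 2 := by
  have hω0 : 0 ≤ volume.real (ball (0 : EuclideanSpace ℝ (Fin N)) 1) := measureReal_nonneg
  refine ContinuousLinearMap.opNorm_le_bound _ (by positivity) fun b => ?_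
  rw [hessAvg_apply hu hk hks hρ, Real.norm_eq_abs, avg, abs_mul,
    abs_of_nonneg (by positivity : 0 ≤ (ρ ^ (N + 2))⁻¹)]
  have hkb := (tsupport_dirDeriv_subset b).trans hks
  have h1 := abs_setIntegral_le (x := y) (y := y) (K := M * (K * ‖b‖))
    (h := fun w => u w * dirDeriv b k (ρ⁻¹ • (w - y))) hρ.le univ
    (fun w hw => by
      rw [abs_mul]
      refine mul_le_mul (huM w (hw.elim id id)) ?_ (abs_nonneg _) hM
      exact ((fderiv ℝ k _).le_opNorm b).trans
        (mul_le_mul_of_nonneg_right (hK _) (norm_nonneg _)))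
    (fun w h1 _ => by rw [scaled_kernel_eq_zero hkb hρ h1, mul_zero])
  rw [setIntegral_univ] at h1
  refine (mul_le_mul_of_nonneg_left h1 (by positivity)).trans (le_of_eq ?_)
  rw [pow_add]
  field_simp

lemma abs_setIntegral_compl_le {h : EuclideanSpace ℝ (Fin N) → ℝ} {K : ℝ} {r : ℝ}
    (hΩ : MeasurableSet Ω) (hK : ∀ w, |h w| ≤ K) (h0 : ∀ w ∉ closedBall y r, h w = 0)
    (hi : Integrable h) (hint : ∫ w, h w = 0) :
    |∫ w in Ω, h w| ≤ K * volume.real (Ωᶜ ∩ closedBall y r) := by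
  have e1 : ∫ w in Ω, h w = -∫ w in Ωᶜ, h w := by
    linarith [integral_add_compl hΩ hi]
  have e2 : ∫ w in Ωᶜ, h w = ∫ w in Ωᶜ ∩ closedBall y r, h w :=
    setIntegral_eq_of_subset_of_forall_sdiff_eq_zero hΩ.compl inter_subset_left
      fun w hw => h0 w fun hwy => hw.2 ⟨hw.1, hwy⟩
  rw [e1, e2, abs_neg, ← Real.norm_eq_abs]
  exact norm_setIntegral_le_of_norm_le_const
    ((measure_mono inter_subset_right).trans_lt measure_closedBall_lt_top) fun w _ => hK w

lemma MemP.norm_hessAvg_sub_le (hu : MemP N 1 z M Ω u) (hk : KernelPair (N + 1) ζ k) {K : ℝ}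
    (hK0 : 0 ≤ K) (hK : ∀ p, ‖fderiv ℝ ζ p‖ ≤ K) {σ : ℝ} (hσ : 0 < σ) (hσρ : σ ≤ ρ)
    (hy : closedBall y ρ ⊆ ball z 1) :
    ‖hessAvg k u y σ - hessAvg k u y ρ‖
      ≤ K * (ρ / σ) ^ (N + 1) * (volume.real (Ωᶜ ∩ closedBall y ρ) / ρ ^ N) := by
  have hρ := hσ.trans_le hσρ
  set v := volume.real (Ωᶜ ∩ closedBall y ρ)
  have hv : 0 ≤ v := measureReal_nonneg
  refine ContinuousLinearMap.opNorm_le_bound _ (by positivity) fun b => ?_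
  have hkb := hk.directional b
  have hd : ∀ t ∈ Icc σ ρ, ‖t * (t ^ (N + 1 + 1))⁻¹ * ∫ x in Ω, dirDeriv b ζ (t⁻¹ • (x - y))‖
      ≤ (σ ^ (N + 1))⁻¹ * (K * ‖b‖ * v) := fun t ht => by
    have ht0 := hσ.trans_le ht.1
    have h1 := abs_setIntegral_compl_le (y := y) (r := ρ) (K := K * ‖b‖)
      (h := fun x => dirDeriv b ζ (t⁻¹ • (x - y))) hu.1.measurableSet
      (fun w => ((fderiv ℝ ζ _).le_opNorm b).trans
        (mul_le_mul_of_nonneg_right (hK _) (norm_nonneg _)))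
      (fun w hw => scaled_kernel_eq_zero hkb.support_left ht0
        fun h => hw (closedBall_subset_closedBall ht.2 h))
      (integrable_scaled hkb.smooth_left.continuous hkb.support_left ht0)
      (by rw [integral_scaled _ y ht0,
        integral_dirDeriv_eq_zero hk.smooth_left hk.support_left b, mul_zero])
    have e : t * (t ^ (N + 1 + 1))⁻¹ = (t ^ (N + 1))⁻¹ := by
      rw [pow_succ t (N + 1)]; field_simp
    rw [e, Real.norm_eq_abs, abs_mul, abs_of_nonneg (by positivity : 0 ≤ (t ^ (N + 1))⁻¹)]
    refine mul_le_mul ?_ h1 (abs_nonneg _) (by positivity)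
    exact inv_anti₀ (by positivity) (pow_le_pow_left₀ hσ.le ht.1 _)
  have h := (convex_Icc σ ρ).norm_image_sub_le_of_norm_hasDerivWithin_le
    (f := avg (N + 1 + 1) (dirDeriv b k) u y) (x := ρ) (y := σ)
    (fun t ht => (hu.hasDerivAt_avg hkb (hσ.trans_le ht.1)
      ((closedBall_subset_closedBall ht.2).trans hy)).hasDerivWithinAt)
    hd (right_mem_Icc.2 hσρ) (left_mem_Icc.2 hσρ)
  rw [sub_apply, hessAvg_apply hu.2.1.continuous hk.smooth_right hk.support_right hσ,
    hessAvg_apply hu.2.1.continuous hk.smooth_right hk.support_right hρ]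
  refine h.trans ?_
  have h2 : ‖σ - ρ‖ ≤ ρ := by
    rw [Real.norm_eq_abs, abs_le]; constructor <;> linarith
  refine (mul_le_mul_of_nonneg_left h2 (by positivity)).trans (le_of_eq ?_)
  rw [div_pow, pow_succ ρ N]
  field_simp

lemma MemP.mem_compl (hu : MemP N 1 z M Ω u) : z ∈ Ωᶜ := fun hz => by
  have h := hu.2.2.2.2.2
  rw [hu.1.frontier_eq] at h
  exact h.2 hz

lemma MemP.fderiv_eq_zero (hu : MemP N 1 z M Ω u) (hx : x ∈ Ωᶜ) (hxz : dist x z < 1) :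
    fderiv ℝ u x = 0 := by
  have h := (hu.2.2.2.1 x ⟨hxz, hx⟩).2
  rwa [gradient, LinearIsometryEquiv.map_eq_zero_iff] at h

lemma exists_scaleField (hP : RadialPair ψ η) (a : EuclideanSpace ℝ (Fin N)) :
    ∃ D : ℝ, 0 < D ∧ ∀ (M : ℝ) (Ω : Set (EuclideanSpace ℝ (Fin N)))
      (z : EuclideanSpace ℝ (Fin N)) (u : EuclideanSpace ℝ (Fin N) → ℝ), 0 < M →
      MemP N 1 z M Ω u →
      ScaleField Ωᶜ z (hessAvg (dirDeriv a η) u) (D * (M + 1)) ∧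
      ∀ x y ρ, dist x z < 3 / 4 → dist y z < 3 / 4 → 0 < ρ → ρ ≤ 1 / 4 → dist x y ≤ 3 * ρ →
        |dirDeriv a u x - dirDeriv a u y - hessAvg (dirDeriv a η) u y ρ (x - y)|
          ≤ D * (M + 1) * ρ := by
  have hk := hP.kernelPair.directional a
  obtain ⟨C, hC0, hC⟩ := exists_taylor_bound hk.smooth_left hk.support_left
  obtain ⟨C', hC0', hC'⟩ := exists_taylor_bound hk.smooth_right hk.support_right
  obtain ⟨K, hK0, hK⟩ := exists_fderiv_bound hk.smooth_left hk.support_left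
  obtain ⟨K', hK0', hK'⟩ := exists_fderiv_bound hk.smooth_right hk.support_right
  set ω := volume.real (ball (0 : EuclideanSpace ℝ (Fin N)) 1) with hω
  have hω0 : 0 ≤ ω := measureReal_nonneg
  set I := ∫ x, |dirDeriv a ψ x| with hI
  have hI0 : 0 ≤ I := integral_nonneg fun _ => abs_nonneg _
  set D₁ := 2 * I + 18 * C * ω + 1152 * C' * ω with hD₁
  have hD₁0 : 0 ≤ D₁ := by positivity
  refine ⟨3 * D₁ + K + 32 * K' * ω + 1, by positivity, fun M Ω z u hM hu => ?_⟩
  set D := (3 * D₁ + K + 32 * K' * ω + 1) * (M + 1) with hD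
  have hD1 : 3 * (D₁ * (M + 1)) ≤ D := by
    rw [hD]; have : 0 ≤ (K + 32 * K' * ω + 1) * (M + 1) := by positivity
    linarith
  have hDK : K ≤ D := by
    have h1 : 0 ≤ (3 * D₁ + 32 * K' * ω + 1) * (M + 1) := by positivity
    have h2 : 0 ≤ K * M := by positivity
    rw [hD]; linarith
  have hDM : 32 * K' * ω * M ≤ D := by
    have h1 : 0 ≤ (3 * D₁ + K + 1) * (M + 1) := by positivity
    have h2 : 0 ≤ K' * ω := by positivity
    rw [hD]; linarith
  have hD₁M : 0 ≤ D₁ * (M + 1) := by positivity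
  have approx : ∀ x y ρ, dist x z < 3 / 4 → dist y z < 3 / 4 → 0 < ρ → ρ ≤ 1 / 4 →
      dist x y ≤ 3 * ρ →
      |dirDeriv a u x - dirDeriv a u y - hessAvg (dirDeriv a η) u y ρ (x - y)|
        ≤ D₁ * (M + 1) * ρ := fun x y ρ hx hy hρ hρ4 hxy => by
    refine (hu.abs_sub_hessAvg_le hP a hC hC' hC0 hC0' hM.le hx hy hρ hρ4 hxy).trans
      (mul_le_mul_of_nonneg_right ?_ hρ.le)
    rw [← hω, ← hI, hD₁]
    have h1 : 0 ≤ I * M := by positivity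
    have h2 : 0 ≤ C * ω * M := by positivity
    have h3 : 0 ≤ C' * ω := by positivity
    linarith
  refine ⟨⟨by positivity, hu.1.measurableSet.compl, hu.mem_compl, ?_, ?_, ?_, ?_⟩, ?_⟩
  · intro x y ρ hx hy hxz hyz hρ hρ4 hxy
    have h := approx x y ρ (by linarith) (by linarith) hρ hρ4 (by linarith)
    rw [dirDeriv, dirDeriv, hu.fderiv_eq_zero hx (by linarith),
      hu.fderiv_eq_zero hy (by linarith), zero_apply, sub_zero, zero_sub, abs_neg] at h
    exact h.trans (mul_le_mul_of_nonneg_right (by linarith) hρ.le)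
  · intro x y ρ hxz hyz hρ hρ4 hxy
    have hv : ∀ v, ‖v‖ = ρ → dist (x + v) z < 3 / 4 := fun v hv => by
      have := dist_triangle (x + v) x z
      rw [dist_self_add_left, hv] at this
      linarith
    refine (norm_sub_le_of_affine_approx (g := dirDeriv a u) (x := x) (y := y) hD₁M hρ
      (fun v hvn => ?_) (fun v hvn => ?_) ?_).trans hD1
    · have := approx (x + v) x ρ (hv v hvn) (by linarith) hρ hρ4
        (by rw [dist_self_add_left, hvn]; linarith)
      rwa [add_sub_cancel_left] at this
    · refine approx (x + v) y ρ (hv v hvn) (by linarith) hρ hρ4 ?_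
      have := dist_triangle (x + v) x y
      rw [dist_self_add_left, hvn] at this
      linarith
    · exact approx x y ρ (by linarith) (by linarith) hρ hρ4 (by linarith)
  · intro y σ ρ hyz hσ hσρ hρ4
    have hρ := hσ.trans_le hσρ
    refine (hu.norm_hessAvg_sub_le hk hK0 hK hσ hσρ
      (closedBall_subset_ball_of_dist (by linarith))).trans ?_
    refine mul_le_mul_of_nonneg_right (mul_le_mul_of_nonneg_right hDK (by positivity)) ?_
    exact div_nonneg measureReal_nonneg (by positivity)
  · have := norm_hessAvg_le (y := z) (ρ := 1 / 4) hu.2.1.continuous hk.smooth_right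
      hk.support_right hK0' hK' hM.le (by norm_num) (fun x hx => hu.2.2.2.2.1 x
        (closedBall_subset_ball_of_dist (by rw [dist_self]; norm_num) hx))
    refine this.trans (le_trans (le_of_eq ?_) hDM)
    rw [← hω]; ring
  · intro x y ρ hx hy hρ hρ4 hxy
    exact (approx x y ρ hx hy hρ hρ4 hxy).trans (mul_le_mul_of_nonneg_right (by linarith) hρ.le)

/-- The gradient grows at most linearly away from a free boundary point. -/
lemma exists_abs_dirDeriv_le (hP : RadialPair ψ η) (a : EuclideanSpace ℝ (Fin N)) :
    ∃ C : ℝ, 0 < C ∧ ∀ (M : ℝ) (Ω : Set (EuclideanSpace ℝ (Fin N)))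
      (z : EuclideanSpace ℝ (Fin N)) (u : EuclideanSpace ℝ (Fin N) → ℝ), 0 < M →
      MemP N 1 z M Ω u → ∀ x, dist x z ≤ 1 / 4 → |dirDeriv a u x| ≤ C * (M + 1) * dist x z := by
  obtain ⟨D, hD0, hD⟩ := exists_scaleField hP a
  obtain ⟨l, C, hl0, hl8, hC0, hC⟩ := ScaleField.exists_norm_le N
  refine ⟨D / l + C * D, by positivity, fun M Ω z u hM hu x hxz => ?_⟩
  obtain ⟨hS, happ⟩ := hD M Ω z u hM hu
  have hgz : dirDeriv a u z = 0 := by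
    rw [dirDeriv, hu.fderiv_eq_zero hu.mem_compl (by simp), zero_apply]
  rcases eq_or_ne x z with rfl | hne
  · simp [hgz]
  have hd0 : 0 < dist x z := dist_pos.2 hne
  obtain ⟨k, hk1, hk2⟩ := exists_nat_pow_near_of_lt_one (x := 4 * dist x z) (y := l)
    (by positivity) (by linarith) hl0 (by linarith)
  have hρ : (0 : ℝ) < 1 / 4 * l ^ k := by positivity
  have hlk : l ^ k ≤ 1 := pow_le_one₀ hl0.le (by linarith)
  have h1 := happ x z (1 / 4 * l ^ k) (by linarith) (by simp) hρ (by linarith) (by linarith)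
  have h2 : |hessAvg (dirDeriv a η) u z (1 / 4 * l ^ k) (x - z)| ≤ C * (D * (M + 1)) * dist x z := by
    rw [dist_eq_norm]
    exact (ContinuousLinearMap.le_opNorm _ _).trans
      (mul_le_mul_of_nonneg_right (hC _ _ _ _ hS k) (norm_nonneg _))
  have h3 : 1 / 4 * l ^ k ≤ dist x z / l := by
    rw [le_div_iff₀ hl0, mul_assoc, ← pow_succ]
    linarith
  rw [hgz, sub_zero] at h1
  have h4 := mul_le_mul_of_nonneg_left h3 (by positivity : 0 ≤ D * (M + 1))
  have h5 : (D / l + C * D) * (M + 1) * dist x z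
      = D * (M + 1) * (dist x z / l) + C * (D * (M + 1)) * dist x z := by
    field_simp
  rw [h5]
  have := abs_sub_abs_le_abs_sub (dirDeriv a u x)
    (hessAvg (dirDeriv a η) u z (1 / 4 * l ^ k) (x - z))
  linarith

end Field

section Decay

variable {N : ℕ} {u ψ η : EuclideanSpace ℝ (Fin N) → ℝ} {x y z : EuclideanSpace ℝ (Fin N)}
  {ρ M : ℝ} {Ω : Set (EuclideanSpace ℝ (Fin N))}

lemma avg_affine (hη : RadialPair ψ η) (c : ℝ) (v y : EuclideanSpace ℝ (Fin N)) (hρ : 0 < ρ) :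
    avg N η (fun x => c + ⟪v, x - y⟫) y ρ = c := by
  have hlin : ∫ x, ⟪v, x - y⟫ * η (ρ⁻¹ • (x - y)) = 0 := by
    rw [integral_sub_right_eq_self (fun x => ⟪v, x⟫ * η (ρ⁻¹ • x)) y]
    have h := integral_neg_eq_self (fun x => ⟪v, x⟫ * η (ρ⁻¹ • x)) volume
    simp only [inner_neg_right, smul_neg, hη.even_right, neg_mul, integral_neg] at h
    linarith
  have i1 := integrable_mul_scaled_kernel (u := fun _ => c) (y := y) continuous_const
    hη.smooth_right.continuous hη.support_right hρ
  have i2 := integrable_mul_scaled_kernel (u := fun x => ⟪v, x - y⟫) (y := y) (by fun_prop)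
    hη.smooth_right.continuous hη.support_right hρ
  rw [avg]
  simp only [add_mul]
  rw [integral_add i1 i2, hlin, add_zero]
  exact avg_const hη c hρ

lemma MemP.avg_eq_of_subset (hu : MemP N 1 z M Ω u) (hP : RadialPair ψ η) (hρ : 0 < ρ)
    (hy : closedBall y ρ ⊆ ball z 1) (hyΩ : closedBall y ρ ⊆ Ω) :
    avg N η u y ρ = u y + (∫ x, ψ x) * ρ ^ 2 / 2 := by
  set I := ∫ x, ψ x
  have hd : ∀ t ∈ Ioc 0 ρ, HasDerivAt (fun t => avg N η u y t - I * t ^ 2 / 2) 0 t := fun t ht => by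
    have h1 := hu.hasDerivAt_avg hP.kernelPair ht.1 ((closedBall_subset_closedBall ht.2).trans hy)
    have h2 : ∫ x in Ω, ψ (t⁻¹ • (x - y)) = t ^ N * I := by
      rw [← integral_scaled ψ y ht.1]
      refine setIntegral_eq_integral_of_forall_compl_eq_zero fun x hx => ?_
      exact scaled_kernel_eq_zero hP.support_left ht.1
        fun h => hx (hyΩ (closedBall_subset_closedBall ht.2 h))
    have h3 : HasDerivAt (fun t : ℝ => I * t ^ 2 / 2) (I * (2 * t) / 2) t := by
      simpa using ((hasDerivAt_pow 2 t).const_mul I).div_const 2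
    refine (h1.sub h3).congr_deriv ?_
    have ht0 := ht.1
    rw [h2]
    field_simp
    ring
  have hconst : ∀ σ ∈ Ioo 0 ρ, avg N η u y σ - I * σ ^ 2 / 2 = avg N η u y ρ - I * ρ ^ 2 / 2 :=
    fun σ hσ => by
    have h := (convex_Icc σ ρ).norm_image_sub_le_of_norm_hasDerivWithin_le
      (f := fun t => avg N η u y t - I * t ^ 2 / 2) (f' := fun _ => 0) (C := 0) (x := ρ) (y := σ)
      (fun t ht => (hd t ⟨hσ.1.trans_le ht.1, ht.2⟩).hasDerivWithinAt) (by simp)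
      (right_mem_Icc.2 hσ.2.le) (left_mem_Icc.2 hσ.2.le)
    rw [zero_mul, norm_le_zero_iff, sub_eq_zero] at h
    exact h
  have hlim : Tendsto (fun t => avg N η u y t - I * t ^ 2 / 2) (𝓝[>] 0) (𝓝 (u y - 0)) := by
    refine (tendsto_avg hP hu.2.1.continuous y).sub ?_
    have : Tendsto (fun t : ℝ => I * t ^ 2 / 2) (𝓝 0) (𝓝 (I * 0 ^ 2 / 2)) :=
      Continuous.tendsto (by fun_prop) 0
    simp only [ne_eq, OfNat.ofNat_ne_zero, not_false_eq_true, zero_pow, mul_zero, zero_div] at this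
    exact this.mono_left nhdsWithin_le_nhds
  have hlim' : Tendsto (fun t => avg N η u y t - I * t ^ 2 / 2) (𝓝[>] 0)
      (𝓝 (avg N η u y ρ - I * ρ ^ 2 / 2)) :=
    tendsto_const_nhds.congr' (by
      filter_upwards [Ioo_mem_nhdsGT hρ] with σ hσ
      exact (hconst σ hσ).symm)
  linarith [tendsto_nhds_unique hlim hlim']

lemma MemP.apply_eq_zero (hu : MemP N 1 z M Ω u) : u z = 0 :=
  (hu.2.2.2.1 z ⟨mem_ball_self one_pos, hu.mem_compl⟩).1

lemma norm_sub_sq_expand (x y x₀ : EuclideanSpace ℝ (Fin N)) :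
    ‖x - x₀‖ ^ 2 = ‖y - x₀‖ ^ 2 + 2 * ⟪y - x₀, x - y⟫ + ‖x - y‖ ^ 2 := by
  rw [← norm_add_sq_real]; congr 2; abel

/-- A solution cannot have a local maximum after subtracting a slowly growing paraboloid centred
at a point of the noncoincidence set. -/
lemma MemP.not_isLocalMax (hu : MemP N 1 z M Ω u) (hP : RadialPair ψ η)
    {x₀ x₁ : EuclideanSpace ℝ (Fin N)} (hx₀ : x₀ ∈ Ω) (hx₁ : dist x₁ z < 1) :
    ¬ IsLocalMax (fun x => u x - (∫ x, ψ x) / 4 * ‖x - x₀‖ ^ 2) x₁ := by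
  intro hmax
  set I := ∫ x, ψ x
  have hI : 0 < I := hP.integral_left_pos
  have hx₁Ω : x₁ ∈ Ω := by
    by_contra hn
    have hdu : HasFDerivAt u (0 : EuclideanSpace ℝ (Fin N) →L[ℝ] ℝ) x₁ := by
      rw [← hu.fderiv_eq_zero hn hx₁]
      exact (hu.2.1.differentiable (by simp) x₁).hasFDerivAt
    have hsq := (((hasFDerivAt_id (𝕜 := ℝ) x₁).sub_const x₀).norm_sq).const_mul (I / 4)
    have h0 := hmax.hasFDerivAt_eq_zero (hdu.sub hsq)
    have h1 := congrArg (fun L : EuclideanSpace ℝ (Fin N) →L[ℝ] ℝ => L (x₁ - x₀)) h0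
    simp at h1
    rcases h1 with h1 | h1
    · exact hI.ne' h1
    · have h2 : ⟪x₁ - x₀, x₁ - x₀⟫ = 0 := by rw [inner_sub_left, h1]
      rw [inner_self_eq_zero, sub_eq_zero] at h2
      exact hn (h2 ▸ hx₀)
  have hnhds : Ω ∩ ball z 1 ∩ {x | u x - I / 4 * ‖x - x₀‖ ^ 2 ≤ u x₁ - I / 4 * ‖x₁ - x₀‖ ^ 2}
      ∈ 𝓝 x₁ :=
    inter_mem (inter_mem (hu.1.mem_nhds hx₁Ω) (isOpen_ball.mem_nhds hx₁)) hmax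
  obtain ⟨ρ, hρ, hball⟩ := Metric.nhds_basis_closedBall.mem_iff.1 hnhds
  have h1 := hu.avg_eq_of_subset hP hρ (fun x hx => (hball hx).1.2) (fun x hx => (hball hx).1.1)
  have h2 := avg_mono (y := x₁) (f := u)
    (g := fun x => (u x₁ + I / 4 * ρ ^ 2) + ⟪(I / 2) • (x₁ - x₀), x - x₁⟫) hP hu.2.1.continuous
    (by fun_prop) hρ (fun x hx => by
      have h3 : u x - I / 4 * ‖x - x₀‖ ^ 2 ≤ u x₁ - I / 4 * ‖x₁ - x₀‖ ^ 2 := (hball hx).2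
      rw [norm_sub_sq_expand x x₁ x₀] at h3
      rw [real_inner_smul_left]
      have h4 : ‖x - x₁‖ ^ 2 ≤ ρ ^ 2 := by
        rw [← dist_eq_norm]
        exact pow_le_pow_left₀ dist_nonneg (mem_closedBall.1 hx) 2
      nlinarith)
  rw [avg_affine hP _ _ _ hρ, h1] at h2
  have : 0 < I * ρ ^ 2 := by positivity
  linarith

lemma MemP.integral_div_le (hu : MemP N 1 z M Ω u) (hP : RadialPair ψ η) :
    (∫ x, ψ x) / 128 ≤ M := by
  set I := ∫ x, ψ x with hI'
  have hI : 0 < I := hP.integral_left_pos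
  have hzc : z ∈ closure Ω := frontier_subset_closure hu.2.2.2.2.2
  have hnear : ball z (1 / 4) ∩ {x | -(I / 128) < u x} ∈ 𝓝 z := by
    refine inter_mem (ball_mem_nhds z (by norm_num)) ?_
    refine (isOpen_lt continuous_const hu.2.1.continuous).mem_nhds ?_
    change -(I / 128) < u z
    rw [hu.apply_eq_zero]
    linarith
  obtain ⟨x₀, ⟨hx₀z, hx₀u⟩, hx₀⟩ := mem_closure_iff_nhds.1 hzc _ hnear
  have hx₀u' : -(I / 128) < u x₀ := hx₀u
  have hx₀z' : dist x₀ z < 1 / 4 := hx₀z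
  set W : EuclideanSpace ℝ (Fin N) → ℝ := fun x => u x - I / 4 * ‖x - x₀‖ ^ 2 with hW
  have hWc : Continuous W := by
    have := hu.2.1.continuous
    fun_prop
  obtain ⟨x₁, hx₁, hmax⟩ := (isCompact_closedBall x₀ (1 / 4)).exists_isMaxOn
    ⟨x₀, mem_closedBall_self (by norm_num)⟩ hWc.continuousOn
  have hx₁' : dist x₁ x₀ ≤ 1 / 4 := hx₁
  have hx₁z : dist x₁ z < 1 := by linarith [dist_triangle x₁ x₀ z]
  rcases hx₁'.lt_or_eq with hlt | heq
  · exact absurd (hmax.isLocalMax (closedBall_mem_nhds_of_mem hlt)) (hu.not_isLocalMax hP hx₀ hx₁z)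
  · have h1 : W x₀ ≤ W x₁ := hmax (mem_closedBall_self (by norm_num))
    simp only [hW, sub_self, norm_zero] at h1
    rw [← dist_eq_norm x₁ x₀, heq] at h1
    have h2 := (le_abs_self _).trans (hu.2.2.2.2.1 x₁ hx₁z)
    linarith

lemma norm_le_sum_abs_single (L : EuclideanSpace ℝ (Fin N) →L[ℝ] ℝ) :
    ‖L‖ ≤ ∑ i, |L (EuclideanSpace.single i 1)| := by
  refine ContinuousLinearMap.opNorm_le_bound _ (Finset.sum_nonneg fun _ _ => abs_nonneg _)
    fun v => ?_
  have e : L v = ∑ i, v i * L (EuclideanSpace.single i 1) := by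
    conv_lhs => rw [← (EuclideanSpace.basisFun (Fin N) ℝ).sum_repr v, map_sum]
    simp
  rw [e, Finset.sum_mul]
  refine (norm_sum_le _ _).trans (Finset.sum_le_sum fun i _ => ?_)
  rw [norm_mul, mul_comm]
  exact mul_le_mul_of_nonneg_left (PiLp.norm_apply_le v i) (norm_nonneg _)

/-- Solutions grow at most quadratically away from a free boundary point. -/
theorem exists_abs_le_mul_dist_sq (hN : 1 ≤ N) : ∃ C : ℝ, 0 < C ∧
    ∀ (M : ℝ) (Ω : Set (EuclideanSpace ℝ (Fin N))) (z : EuclideanSpace ℝ (Fin N))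
      (u : EuclideanSpace ℝ (Fin N) → ℝ), 0 < M → MemP N 1 z M Ω u →
      ∀ x, dist x z < 1 → |u x| ≤ C * M * dist x z ^ 2 := by
  obtain ⟨ψ, η, hP⟩ := exists_radialPair hN
  choose K hK0 hK using fun i : Fin N => exists_abs_dirDeriv_le hP (EuclideanSpace.single i 1)
  have hI : 0 < ∫ x, ψ x := hP.integral_left_pos
  set c := (∫ x, ψ x) / 128 with hc
  have hc0 : 0 < c := by positivity
  have hS0 : 0 ≤ ∑ i, K i := Finset.sum_nonneg fun i _ => (hK0 i).le
  refine ⟨(∑ i, K i) * (1 + 1 / c) + 16, by positivity, fun M Ω z u hM hu x hx => ?_⟩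
  have hd0 : 0 ≤ dist x z := dist_nonneg
  rcases le_or_gt (dist x z) (1 / 4) with hxz | hxz
  · have hMc : M + 1 ≤ (1 + 1 / c) * M := by
      have h1 : 1 ≤ 1 / c * M := by
        rw [one_div, inv_mul_eq_div, one_le_div hc0]
        exact hu.integral_div_le hP
      linarith
    have hgrad : ∀ w ∈ closedBall z (dist x z),
        ‖fderiv ℝ u w‖ ≤ (∑ i, K i) * (M + 1) * dist x z := fun w hw => by
      have hw' : dist w z ≤ dist x z := hw
      refine (norm_le_sum_abs_single _).trans ?_
      rw [Finset.sum_mul, Finset.sum_mul]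
      refine Finset.sum_le_sum fun i _ => (hK i M Ω z u hM hu w (hw'.trans hxz)).trans ?_
      have := hK0 i
      exact mul_le_mul_of_nonneg_left hw' (by positivity)
    have h := (convex_closedBall z (dist x z)).norm_image_sub_le_of_norm_fderiv_le (𝕜 := ℝ)
      (fun w _ => hu.2.1.differentiable (by simp) w) hgrad (mem_closedBall_self hd0)
      (mem_closedBall.2 le_rfl)
    rw [hu.apply_eq_zero, sub_zero, Real.norm_eq_abs, ← dist_eq_norm] at h
    refine h.trans ?_
    have h2 := mul_le_mul_of_nonneg_left hMc (mul_nonneg hS0 (sq_nonneg (dist x z)))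
    have h3 : 0 ≤ 16 * M * dist x z ^ 2 := by positivity
    linarith
  · refine (hu.2.2.2.2.1 x hx).trans ?_
    have h1 : 0 ≤ (∑ i, K i) * (1 + 1 / c) * M * dist x z ^ 2 := by positivity
    have h2 : M * 1 ≤ M * (16 * dist x z ^ 2) :=
      mul_le_mul_of_nonneg_left (by nlinarith) hM.le
    linarith

end Decay

/-- the quadratic decay estimate `S_j ≤ C M 2^{-2j}` for all `j`. -/
theorem quadratic_decay (N : ℕ) (hN : 2 ≤ N) :
    ∃ C : ℝ, 0 < C ∧
      ∀ (M : ℝ), 0 < M →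
        ∀ (Ω : Set (EuclideanSpace ℝ (Fin N))) (z : EuclideanSpace ℝ (Fin N))
          (u : EuclideanSpace ℝ (Fin N) → ℝ),
          MemP N 1 z M Ω u →
            ∀ j : ℕ, Sj N z u j ≤ C * M * (2 : ℝ) ^ (-(2 * (j : ℤ))) := by
  obtain ⟨C, hC0, hC⟩ := exists_abs_le_mul_dist_sq (N := N) (by omega)
  refine ⟨C, hC0, fun M hM Ω z u hu j => ?_⟩
  have hpos : (0 : ℝ) < (2 : ℝ) ^ (-(j : ℤ)) := by positivity
  have hle : (2 : ℝ) ^ (-(j : ℤ)) ≤ 1 := zpow_le_one_of_nonpos₀ (by norm_num) (by omega)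
  refine csSup_le ((nonempty_ball.2 hpos).image _) ?_
  rintro _ ⟨x, hx, rfl⟩
  have hxz := mem_ball.1 hx
  refine (hC M Ω z u hM hu x (hxz.trans_le hle)).trans
    (mul_le_mul_of_nonneg_left ?_ (by positivity))
  rw [show -(2 * (j : ℤ)) = -(j : ℤ) * 2 by ring, zpow_mul]
  exact_mod_cast pow_le_pow_left₀ dist_nonneg hxz.le 2
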